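/- arXiv:2205.15594 — 7 statements merged into one kernel-verified Lean document; each statement's English description precedes it below -/
import Mathlib

section
/- Under the same hypotheses (a)–(d) as in the approximate integration by parts theorem (ν a probability measure on M, f ∈ H¹(ν) with ∫ f² dν = 1 and ∫ Γ(f) dν ≤ Λ, weak eigenfunctions p₁,…,p_{k−1} ∈ H¹(ν) with positive eigenvalues λ₁,…,λ_{k−1}, pairwise L²(ν)-orthogonal, ∫ Γ(p_i,g) dν = λ_i ∫ p_i g dν for all g ∈ H¹(ν), ∫ (f − Σ p_j) p_i dν = 0 for all i, and the improved Poincaré inequality λ ∫ g² dν ≤ ∫ Γ(g) dν for all g ∈ H¹(ν) with ∫ g p_i dν = 0 for all i), it holds for every g ∈ H¹(ν) with ∫ g p_i dν = 0 for all i that | ∫ ( λ f g − Γ(f, g) ) dν | ≤ [ Λ − λ + Σ_{i=1}^{k−1} (λ − λ_i) ∫ p_i² dν ]^{1/2} · ( ∫ Γ(g) dν )^{1/2}. -/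
open MeasureTheory Real

/-- Membership in `H¹(ν)`: `C¹`, centered, with integrable carré du champ
`Γ(f)(x) = a(x) f'(x)²`. -/
def MemH1 (a : ℝ → ℝ) (ν : MeasureTheory.Measure ℝ) (f : ℝ → ℝ) : Prop :=
  ContDiff ℝ 1 f ∧ (∫ x, f x ∂ν) = 0 ∧
    MeasureTheory.Integrable (fun x => a x * (deriv f x) ^ 2) ν

open LinearMap (BilinForm) in
/-- Pythagoras for two symmetric bilinear forms and joint eigenvectors `p i`. -/
lemma pythagoras_of_eigenvectors {V ι : Type*} [AddCommGroup V] [Module ℝ V] [Fintype ι]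
    (L G : BilinForm ℝ V) (hL : ∀ u v, L u v = L v u) (hG : ∀ u v, G u v = G v u)
    (p : ι → V) (l : ι → ℝ) (horth : ∀ i j, i ≠ j → L (p i) (p j) = 0)
    (heig : ∀ i v, G (p i) v = l i * L (p i) v)
    (u q : V) (c : ι → ℝ) (hu : u = q + ∑ i, c i • p i) (hq : ∀ i, L q (p i) = 0) :
    L u u = L q q + ∑ i, c i ^ 2 * L (p i) (p i) ∧
      G u u = G q q + ∑ i, l i * (c i ^ 2 * L (p i) (p i)) := by
  classical
  have hpq : ∀ i, L (p i) q = 0 := fun i => by rw [hL, hq]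
  have hpu : ∀ i, L (p i) u = c i * L (p i) (p i) := by
    intro i
    rw [hu, map_add, hpq, map_sum, Finset.sum_eq_single i]
    · simp
    · intro j _ hj
      simp [horth i j hj.symm]
    · simp
  have key : ∀ B : BilinForm ℝ V, (∀ u v, B u v = B v u) → (∀ i, B (p i) q = 0) →
      B u u = B q q + ∑ i, c i * B (p i) u := by
    intro B hB hBq
    have h1 : ∀ v, B u v = B q v + ∑ i, c i * B (p i) v := by
      intro v
      rw [hu]
      simp [LinearMap.sum_apply]
    rw [h1 u, hB q u, h1 q]
    simp [hBq]
  constructor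
  · rw [key L hL hpq]
    simp only [hpu]
    congr 1
    exact Finset.sum_congr rfl fun i _ => by ring
  · rw [key G hG fun i => by rw [heig, hpq, mul_zero]]
    simp only [heig, hpu]
    congr 1
    exact Finset.sum_congr rfl fun i _ => by ring

open LinearMap (BilinForm) in
/-- A Poincaré inequality on the orthogonal complement of joint eigenvectors with positive
eigenvalues gives one on the whole space. -/
lemma le_mul_of_poincare_orthogonal {V ι : Type*} [AddCommGroup V] [Module ℝ V] [Fintype ι]
    (L G : BilinForm ℝ V) (hL : ∀ u v, L u v = L v u) (hG : ∀ u v, G u v = G v u)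
    (hL0 : ∀ u, 0 ≤ L u u) (hG0 : ∀ u, 0 ≤ G u u)
    (p : ι → V) (l : ι → ℝ) (hl : ∀ i, 0 < l i) (horth : ∀ i j, i ≠ j → L (p i) (p j) = 0)
    (heig : ∀ i v, G (p i) v = l i * L (p i) v) (lam : ℝ) (hlam : 0 < lam)
    (hpoinc : ∀ v, (∀ i, L v (p i) = 0) → lam * L v v ≤ G v v) (u : V) :
    L u u ≤ (lam⁻¹ + ∑ i, (l i)⁻¹) * G u u := by
  classical
  set c : ι → ℝ := fun i => L u (p i) / L (p i) (p i) with hc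
  set q := u - ∑ i, c i • p i with hqdef
  have hq : ∀ i, L q (p i) = 0 := by
    intro i
    have h1 : L q (p i) = L u (p i) - c i * L (p i) (p i) := by
      rw [hqdef, map_sub, LinearMap.sub_apply, map_sum, LinearMap.sum_apply,
        Finset.sum_eq_single i]
      · simp
      · intro j _ hj
        simp [horth j i hj]
      · simp
    rw [h1]
    by_cases h0 : L (p i) (p i) = 0
    · have hCS := LinearMap.BilinForm.apply_mul_apply_le_of_forall_zero_le L hL0 u (p i)
      rw [h0, hL (p i) u, mul_zero] at hCS
      have : L u (p i) = 0 := by nlinarith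
      simp [h0, this]
    · simp only [hc]
      field_simp
      simp
  obtain ⟨h1, h2⟩ := pythagoras_of_eigenvectors L G hL hG p l horth heig u q c
    (by rw [hqdef]; abel) hq
  have hm : ∀ i, 0 ≤ c i ^ 2 * L (p i) (p i) := fun i => mul_nonneg (sq_nonneg _) (hL0 _)
  have hterm : ∀ i ∈ Finset.univ, 0 ≤ l i * (c i ^ 2 * L (p i) (p i)) :=
    fun i _ => mul_nonneg (hl i).le (hm i)
  have hqu : G q q ≤ G u u := by
    linarith [Finset.sum_nonneg hterm]
  rw [h1, add_mul, Finset.sum_mul]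
  refine add_le_add ?_ (Finset.sum_le_sum fun i hi => ?_)
  · rw [inv_mul_eq_div, le_div_iff₀ hlam, mul_comm]
    exact (hpoinc q hq).trans hqu
  · rw [inv_mul_eq_div, le_div_iff₀ (hl i), mul_comm]
    linarith [Finset.single_le_sum hterm hi, hG0 q]

open LinearMap (BilinForm) in
/-- The approximate integration by parts inequality for abstract symmetric bilinear forms. -/
lemma abs_sub_le_sqrt_mul_sqrt_of_poincare_orthogonal {V ι : Type*} [AddCommGroup V] [Module ℝ V]
    [Fintype ι] (L G : BilinForm ℝ V) (hL : ∀ u v, L u v = L v u) (hG : ∀ u v, G u v = G v u)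
    (hL0 : ∀ u, 0 ≤ L u u) (p : ι → V) (l : ι → ℝ)
    (horth : ∀ i j, i ≠ j → L (p i) (p j) = 0)
    (heig : ∀ i v, G (p i) v = l i * L (p i) v) (lam : ℝ) (hlam : 0 < lam)
    (hpoinc : ∀ v, (∀ i, L v (p i) = 0) → lam * L v v ≤ G v v)
    (f g : V) (Λ : ℝ) (hf : L f f = 1) (hfΓ : G f f ≤ Λ)
    (hperp : ∀ i, L (f - ∑ j, p j) (p i) = 0) (hg : ∀ i, L g (p i) = 0) :
    |lam * L f g - G f g| ≤
      √(Λ - lam + ∑ i, (lam - l i) * L (p i) (p i)) * √(G g g) := by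
  set q := f - ∑ j, p j with hqdef
  obtain ⟨h1, h2⟩ := pythagoras_of_eigenvectors L G hL hG p l horth heig f q (fun _ => 1)
    (by simp [hqdef]) hperp
  simp only [one_pow, one_mul] at h1 h2
  have hLg : L q g = L f g := by
    simp [hqdef, LinearMap.sum_apply, hL _ g, hg]
  have hGg : G q g = G f g := by
    simp [hqdef, LinearMap.sum_apply, heig, hL _ g, hg]
  have hB : ∀ t : ℝ, 0 ≤ (G g g - lam * L g g) * (t * t) +
      (2 * (G q g - lam * L q g)) * t + (G q q - lam * L q q) := by
    intro t
    have := hpoinc (q + t • g) (by intro i; simp [hperp, hg])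
    simp only [map_add, map_smul, LinearMap.add_apply, LinearMap.smul_apply, smul_eq_mul,
      hL g q, hG g q] at this
    linarith
  have hD := discrim_le_zero hB
  have hgg : 0 ≤ G g g - lam * L g g := by linarith [hpoinc g hg]
  have hqq : 0 ≤ G q q - lam * L q q := by linarith [hpoinc q hperp]
  have hA : G q q - lam * L q q ≤ Λ - lam + ∑ i, (lam - l i) * L (p i) (p i) := by
    simp only [sub_mul, Finset.sum_sub_distrib, ← Finset.mul_sum] at h2 ⊢
    nlinarith
  rw [← Real.sqrt_mul (hqq.trans hA), ← hLg, ← hGg]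
  apply Real.abs_le_sqrt
  calc (lam * L q g - G q g) ^ 2
      ≤ (G q q - lam * L q q) * (G g g - lam * L g g) := by
        unfold discrim at hD; linarith
    _ ≤ _ := by
        apply mul_le_mul hA _ hgg (hqq.trans hA)
        linarith [mul_nonneg hlam.le (hL0 g)]

section CarreDuChamp

variable {a : ℝ → ℝ} {ν : Measure ℝ}

lemma integrable_carreDuChamp (ha : ∀ x, 0 ≤ a x) {u v : ℝ → ℝ}
    (hu : Integrable (fun x => a x * deriv u x ^ 2) ν)
    (hv : Integrable (fun x => a x * deriv v x ^ 2) ν) :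
    Integrable (fun x => a x * deriv u x * deriv v x) ν := by
  refine (hu.add hv).mono' ?_ (ae_of_all _ fun x => ?_)
  · have : (fun x => a x * deriv u x * deriv v x) =
        fun x => (a x * deriv u x ^ 2) * (deriv v x / deriv u x) := by
      ext x
      by_cases h : deriv u x = 0
      · simp [h]
      · field_simp
    rw [this]
    exact hu.aestronglyMeasurable.mul
      ((measurable_deriv v).div (measurable_deriv u)).aestronglyMeasurable
  · simp only [Pi.add_apply, Real.norm_eq_abs]
    rw [abs_le]
    constructor <;>
    nlinarith [ha x, mul_nonneg (ha x) (sq_nonneg (deriv u x + deriv v x)),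
      mul_nonneg (ha x) (sq_nonneg (deriv u x - deriv v x)),
      mul_nonneg (ha x) (sq_nonneg (deriv u x)), mul_nonneg (ha x) (sq_nonneg (deriv v x))]

variable (a ν) in
/-- The square-integrable elements of `H¹(ν)`, as a vector space. -/
def h1L2 [IsProbabilityMeasure ν] (ha : ∀ x, 0 ≤ a x) : Submodule ℝ (ℝ → ℝ) where
  carrier := {u | MemH1 a ν u ∧ MemLp u 2 ν}
  zero_mem' := by
    refine ⟨⟨contDiff_const, by simp, ?_⟩, MemLp.zero⟩
    have : deriv (0 : ℝ → ℝ) = 0 := deriv_const' 0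
    simp [this]
  add_mem' := by
    rintro u v ⟨⟨hu, hu0, hΓu⟩, hu2⟩ ⟨⟨hv, hv0, hΓv⟩, hv2⟩
    refine ⟨⟨hu.add hv, ?_, ?_⟩, hu2.add hv2⟩
    · simp only [Pi.add_apply]
      rw [integral_add (hu2.integrable one_le_two) (hv2.integrable one_le_two), hu0, hv0,
        add_zero]
    · refine ((hΓu.add hΓv).add ((integrable_carreDuChamp ha hΓu hΓv).const_mul 2)).congr
        (ae_of_all _ fun x => ?_)
      simp only [Pi.add_apply]
      rw [deriv_add (hu.differentiable one_ne_zero x) (hv.differentiable one_ne_zero x)]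
      ring
  smul_mem' := by
    rintro c u ⟨⟨hu, hu0, hΓu⟩, hu2⟩
    refine ⟨⟨contDiff_const.smul hu, ?_, ?_⟩, hu2.const_smul c⟩
    · simp [integral_const_mul, hu0]
    · refine (hΓu.const_mul (c ^ 2)).congr (ae_of_all _ fun x => ?_)
      simp only
      rw [deriv_const_smul c (hu.differentiable one_ne_zero x), smul_eq_mul]
      ring

variable [IsProbabilityMeasure ν]

variable (a ν) in
/-- The `L²(ν)` inner product on `h1L2`. -/
noncomputable def l2Form (ha : ∀ x, 0 ≤ a x) : LinearMap.BilinForm ℝ (h1L2 a ν ha) :=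
  have int (u v : h1L2 a ν ha) : Integrable (fun x => u.1 x * v.1 x) ν :=
    u.2.2.integrable_mul v.2.2
  LinearMap.mk₂ ℝ (fun u v => ∫ x, u.1 x * v.1 x ∂ν)
    (fun u v w => by
      rw [← integral_add (int u w) (int v w)]
      exact integral_congr_ae (ae_of_all _ fun x => add_mul _ _ _))
    (fun c u v => by
      rw [smul_eq_mul, ← integral_const_mul]
      exact integral_congr_ae (ae_of_all _ fun x => mul_assoc _ _ _))
    (fun u v w => by
      rw [← integral_add (int u v) (int u w)]
      exact integral_congr_ae (ae_of_all _ fun x => mul_add _ _ _))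
    (fun c u v => by
      rw [smul_eq_mul, ← integral_const_mul]
      exact integral_congr_ae (ae_of_all _ fun x => mul_left_comm _ _ _))

variable (a ν) in
/-- The energy form `∫ Γ(u, v) dν` on `h1L2`. -/
noncomputable def energyForm (ha : ∀ x, 0 ≤ a x) : LinearMap.BilinForm ℝ (h1L2 a ν ha) :=
  have diff (u : h1L2 a ν ha) (x : ℝ) : DifferentiableAt ℝ u.1 x :=
    u.2.1.1.differentiable one_ne_zero x
  have int (u v : h1L2 a ν ha) := integrable_carreDuChamp ha u.2.1.2.2 v.2.1.2.2
  LinearMap.mk₂ ℝ (fun u v => ∫ x, a x * deriv u.1 x * deriv v.1 x ∂ν)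
    (fun u v w => by
      rw [← integral_add (int u w) (int v w)]
      refine integral_congr_ae (ae_of_all _ fun x => ?_)
      simp only [Submodule.coe_add]
      rw [deriv_add (diff u x) (diff v x)]
      ring)
    (fun c u v => by
      rw [smul_eq_mul, ← integral_const_mul]
      refine integral_congr_ae (ae_of_all _ fun x => ?_)
      simp only [Submodule.coe_smul]
      rw [deriv_const_smul c (diff u x), smul_eq_mul]
      ring)
    (fun u v w => by
      rw [← integral_add (int u v) (int u w)]
      refine integral_congr_ae (ae_of_all _ fun x => ?_)
      simp only [Submodule.coe_add]
      rw [deriv_add (diff v x) (diff w x)]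
      ring)
    (fun c u v => by
      rw [smul_eq_mul, ← integral_const_mul]
      refine integral_congr_ae (ae_of_all _ fun x => ?_)
      simp only [Submodule.coe_smul]
      rw [deriv_const_smul c (diff v x), smul_eq_mul]
      ring)

lemma l2Form_apply (ha : ∀ x, 0 ≤ a x) (u v : h1L2 a ν ha) :
    l2Form a ν ha u v = ∫ x, u.1 x * v.1 x ∂ν := rfl

lemma energyForm_apply (ha : ∀ x, 0 ≤ a x) (u v : h1L2 a ν ha) :
    energyForm a ν ha u v = ∫ x, a x * deriv u.1 x * deriv v.1 x ∂ν := rfl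

lemma memLp_two_of_bounded {u : ℝ → ℝ} (hu : Continuous u) {K : ℝ} (hK : ∀ x, |u x| ≤ K) :
    MemLp u 2 ν :=
  MemLp.of_bound hu.aestronglyMeasurable K (ae_of_all _ hK)

/-- A weak eigenfunction of positive eigenvalue is square integrable. Without square
integrability the eigenvalue equation forces `Γ(p) = 0` almost everywhere, and testing it against
a centered bounded function of `p` shows that `p` is almost surely constant. -/
lemma memLp_two_of_weak_eigenfunction {p : ℝ → ℝ} (hp : MemH1 a ν p) {l : ℝ} (hl : 0 < l)
    (ha : ∀ x, 0 ≤ a x)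
    (heig : ∀ g, MemH1 a ν g →
      ∫ x, a x * deriv p x * deriv g x ∂ν = l * ∫ x, p x * g x ∂ν) :
    MemLp p 2 ν := by
  have hcont := hp.1.continuous
  rw [memLp_two_iff_integrable_sq hcont.aestronglyMeasurable]
  by_contra hnot
  have hΓ0 : ∫ x, a x * deriv p x ^ 2 ∂ν = 0 := by
    have h := heig p hp
    have e1 : ∫ x, p x * p x ∂ν = 0 := by
      simp only [← sq]
      exact integral_undef hnot
    rw [e1, mul_zero] at h
    rw [← h]
    exact integral_congr_ae (ae_of_all _ fun x => by ring)
  have hae : ∀ᵐ x ∂ν, a x * deriv p x = 0 := by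
    rw [integral_eq_zero_iff_of_nonneg (fun x => mul_nonneg (ha x) (sq_nonneg _)) hp.2.2] at hΓ0
    filter_upwards [hΓ0] with x hx
    simpa using hx
  set w : ℝ → ℝ := fun y => ((1 + y ^ 2) ^ 2)⁻¹ with hw
  have hpos : ∀ y : ℝ, 0 < (1 + y ^ 2) ^ 2 := fun y => by positivity
  have hwC : ContDiff ℝ 1 w := by
    apply ContDiff.inv (by fun_prop)
    exact fun y => (hpos y).ne'
  have hw0 : ∀ y, 0 < w y := fun y => inv_pos.mpr (hpos y)
  have bounded : ∀ r : ℝ → ℝ, Continuous r → (∀ y, |r y| ≤ (1 + y ^ 2) ^ 2) →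
      Integrable (fun x => r (p x) * w (p x)) ν := by
    intro r hr hb
    have hle : ∀ x, |r (p x) * w (p x)| ≤ 1 := fun x => by
      rw [abs_mul, abs_of_pos (hw0 _), hw, ← div_eq_mul_inv, div_le_one (hpos _)]
      exact hb _
    exact (memLp_two_of_bounded ((hr.comp hcont).mul (hwC.continuous.comp hcont))
      hle).integrable one_le_two
  have i0 : Integrable (fun x => w (p x)) ν := by
    simpa using bounded (fun _ => 1) continuous_const fun y => by
      rw [abs_one]; nlinarith [sq_nonneg y, sq_nonneg (y ^ 2)]
  have i1 : Integrable (fun x => p x * w (p x)) ν :=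
    bounded (fun y => y) continuous_id fun y => by
      rw [abs_le]; constructor <;>
        nlinarith [sq_nonneg y, sq_nonneg (y ^ 2), sq_nonneg (y - 1), sq_nonneg (y + 1)]
  have i2 : Integrable (fun x => p x ^ 2 * w (p x)) ν :=
    bounded (fun y => y ^ 2) (by fun_prop) fun y => by
      rw [abs_of_nonneg (sq_nonneg y)]; nlinarith [sq_nonneg y, sq_nonneg (y ^ 2)]
  have hW : 0 < ∫ x, w (p x) ∂ν := by
    rw [integral_pos_iff_support_of_nonneg (fun x => (hw0 _).le) i0]
    have : Function.support (fun x => w (p x)) = Set.univ := by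
      ext x; simp [(hw0 (p x)).ne']
    rw [this]
    simp
  set c := (∫ x, p x * w (p x) ∂ν) / ∫ x, w (p x) ∂ν with hc
  set h : ℝ → ℝ := fun x => (p x - c) * w (p x) with hh
  have hhC : ContDiff ℝ 1 h := (hp.1.sub contDiff_const).mul (hwC.comp hp.1)
  have hh0 : ∫ x, h x ∂ν = 0 := by
    simp only [hh, sub_mul]
    rw [integral_sub i1 (i0.const_mul c), integral_const_mul, hc]
    field_simp
    simp
  have hderiv : ∀ x, ∃ d, deriv h x = d * deriv p x := by
    intro x
    have hpx := (hp.1.differentiable one_ne_zero x).hasDerivAt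
    have hwx := ((hwC.differentiable one_ne_zero) (p x)).hasDerivAt
    refine ⟨w (p x) + (p x - c) * deriv w (p x), ?_⟩
    have hx : HasDerivAt h (deriv p x * w (p x) + (p x - c) * (deriv w (p x) * deriv p x)) x :=
      (hpx.sub_const c).mul (hwx.comp x hpx)
    rw [hx.deriv]
    ring
  have hhmem : MemH1 a ν h := by
    refine ⟨hhC, hh0, (integrable_zero ℝ ℝ ν).congr ?_⟩
    filter_upwards [hae] with x hx
    obtain ⟨d, hd⟩ := hderiv x
    rw [hd, Pi.zero_apply]
    linear_combination -(d ^ 2 * deriv p x) * hx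
  have hph : ∫ x, p x * h x ∂ν = 0 := by
    have h1 : ∫ x, a x * deriv p x * deriv h x ∂ν = 0 :=
      integral_eq_zero_of_ae (by filter_upwards [hae] with x hx; simp [hx])
    have h2 := heig h hhmem
    rw [h1] at h2
    simpa [hl.ne'] using h2.symm
  have ih : Integrable h ν := by
    simp only [hh, sub_mul]
    exact i1.sub (i0.const_mul c)
  have iph : Integrable (fun x => p x * h x) ν := by
    refine (i2.sub (i1.const_mul c)).congr (ae_of_all _ fun x => ?_)
    simp only [hh, Pi.sub_apply]
    ring
  have hsq : ∫ x, (p x - c) ^ 2 * w (p x) ∂ν = 0 := by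
    calc ∫ x, (p x - c) ^ 2 * w (p x) ∂ν = ∫ x, (p x * h x - c * h x) ∂ν :=
          integral_congr_ae (ae_of_all _ fun x => by simp only [hh]; ring)
      _ = 0 := by
          rw [integral_sub iph (ih.const_mul c), integral_const_mul, hph, hh0]
          simp
  have isq : Integrable (fun x => (p x - c) ^ 2 * w (p x)) ν := by
    refine (iph.sub (ih.const_mul c)).congr (ae_of_all _ fun x => ?_)
    simp only [hh, Pi.sub_apply]
    ring
  rw [integral_eq_zero_iff_of_nonneg (fun x => mul_nonneg (sq_nonneg _) (hw0 _).le) isq] at hsq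
  refine hnot ((integrable_const (c ^ 2)).congr ?_)
  filter_upwards [hsq] with x hx
  have : p x - c = 0 := by simpa [(hw0 (p x)).ne'] using hx
  rw [sub_eq_zero.mp this]

/-- If the bounded elements of `H¹(ν)` satisfy a Poincaré inequality, then every element of
`H¹(ν)` is square integrable. -/
lemma MemH1.memLp_two_of_poincare {C : ℝ} (hC : 0 ≤ C)
    (hpoinc : ∀ u, MemH1 a ν u → MemLp u 2 ν →
      ∫ x, u x ^ 2 ∂ν ≤ C * ∫ x, a x * deriv u x ^ 2 ∂ν)
    (ha : ∀ x, 0 ≤ a x) {g : ℝ → ℝ} (hg : MemH1 a ν g) : MemLp g 2 ν := by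
  have hcont := hg.1.continuous
  set E := C * ∫ x, a x * deriv g x ^ 2 ∂ν with hE
  have hE0 : 0 ≤ E :=
    mul_nonneg hC (integral_nonneg fun x => mul_nonneg (ha x) (sq_nonneg _))
  set φ : ℕ → ℝ → ℝ := fun n y => (n + 1 : ℝ) * arctan (y / (n + 1)) with hφ
  have hφd : ∀ n y, HasDerivAt (φ n) (1 / (1 + (y / (n + 1)) ^ 2)) y := by
    intro n y
    have hn : (n + 1 : ℝ) ≠ 0 := by positivity
    refine ((((hasDerivAt_id y).div_const (n + 1 : ℝ)).arctan).const_mul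
      (n + 1 : ℝ)).congr_deriv ?_
    simp only [id]
    field_simp
  have hφC : ∀ n, ContDiff ℝ 1 (φ n) := fun n =>
    contDiff_const.mul (contDiff_arctan.comp (contDiff_id.div_const _))
  have hd0 : ∀ (n : ℕ) (y : ℝ), 0 ≤ 1 / (1 + (y / (n + 1)) ^ 2) := fun n y => by positivity
  have hd1 : ∀ (n : ℕ) (y : ℝ), 1 / (1 + (y / (n + 1)) ^ 2) ≤ 1 := fun n y => by
    rw [div_le_one (by positivity)]
    linarith [sq_nonneg (y / (n + 1 : ℝ))]
  have hφle : ∀ n y, |φ n y| ≤ |y| := by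
    intro n y
    have h := Convex.norm_image_sub_le_of_norm_hasDerivWithin_le (f := φ n) (C := 1)
      (s := Set.univ) (x := 0) (y := y) (fun x _ => (hφd n x).hasDerivWithinAt)
      (fun x _ => by rw [Real.norm_eq_abs, abs_of_nonneg (hd0 n x)]; exact hd1 n x)
      convex_univ trivial trivial
    simpa [hφ] using h
  have hφb : ∀ n y, |φ n y| ≤ (n + 1) * (π / 2) := by
    intro n y
    rw [hφ, abs_mul, abs_of_pos (by positivity : (0 : ℝ) < n + 1)]
    gcongr
    exact abs_le.mpr ⟨(neg_pi_div_two_lt_arctan _).le, (arctan_lt_pi_div_two _).le⟩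
  have hφlim : ∀ y, Filter.Tendsto (fun n => φ n y) Filter.atTop (nhds y) := by
    intro y
    have hder : HasDerivAt (fun t => arctan (y * t)) y 0 := by
      have := ((hasDerivAt_id (0 : ℝ)).const_mul y).arctan
      simpa using this
    have h := hder.tendsto_slope_zero_right
    have hs : Filter.Tendsto (fun n : ℕ => (1 : ℝ) / (n + 1)) Filter.atTop
        (nhdsWithin 0 (Set.Ioi 0)) :=
      tendsto_nhdsWithin_iff.mpr ⟨tendsto_one_div_add_atTop_nhds_zero_nat,
        Filter.Eventually.of_forall fun n => by simp only [Set.mem_Ioi]; positivity⟩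
    refine (h.comp hs).congr fun n => ?_
    simp [hφ, div_eq_mul_inv]
  set m : ℕ → ℝ := fun n => ∫ x, φ n (g x) ∂ν with hm
  have hcontφ : ∀ n, Continuous fun x => φ n (g x) := fun n => (hφC n).continuous.comp hcont
  have hu2 : ∀ n, MemLp (fun x => φ n (g x)) 2 ν := fun n =>
    memLp_two_of_bounded (hcontφ n) fun x => hφb n (g x)
  have hh2 : ∀ n, MemLp (fun x => φ n (g x) - m n) 2 ν := fun n =>
    (hu2 n).sub (memLp_const (m n))
  have hvar : ∀ n, ∫ x, (φ n (g x) - m n) ^ 2 ∂ν ≤ E := by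
    intro n
    have hder : ∀ x, deriv (fun x => φ n (g x) - m n) x =
        1 / (1 + (g x / (n + 1)) ^ 2) * deriv g x := fun x =>
      (((hφd n (g x)).comp x (hg.1.differentiable one_ne_zero x).hasDerivAt).sub_const
        (m n)).deriv
    have hΓle : ∀ x, a x * deriv (fun x => φ n (g x) - m n) x ^ 2 ≤ a x * deriv g x ^ 2 := by
      intro x
      rw [hder, mul_pow]
      apply mul_le_mul_of_nonneg_left _ (ha x)
      exact mul_le_of_le_one_left (sq_nonneg _) (pow_le_one₀ (hd0 n _) (hd1 n _))
    have hΓ : Integrable (fun x => a x * deriv (fun x => φ n (g x) - m n) x ^ 2) ν := by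
      refine hg.2.2.mono' ?_ (ae_of_all _ fun x => ?_)
      · have : (fun x => a x * deriv (fun x => φ n (g x) - m n) x ^ 2) =
            fun x => (a x * deriv g x ^ 2) * (1 / (1 + (g x / (n + 1)) ^ 2)) ^ 2 := by
          ext x
          rw [hder]
          ring
        rw [this]
        refine hg.2.2.aestronglyMeasurable.mul (Measurable.aestronglyMeasurable ?_)
        have := hcont.measurable
        fun_prop
      · rw [Real.norm_eq_abs, abs_of_nonneg (mul_nonneg (ha x) (sq_nonneg _))]
        exact hΓle x
    have hmem : MemH1 a ν (fun x => φ n (g x) - m n) := by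
      refine ⟨((hφC n).comp hg.1).sub contDiff_const, ?_, hΓ⟩
      rw [integral_sub ((hu2 n).integrable one_le_two) (integrable_const _)]
      simp [hm]
    refine (hpoinc _ hmem (hh2 n)).trans ?_
    exact mul_le_mul_of_nonneg_left (integral_mono hΓ hg.2.2 hΓle) hC
  obtain ⟨R, hR⟩ : ∃ R : ℕ, 0 < ν {x | |g x| ≤ R} := by
    by_contra! hcon
    have hU : (⋃ R : ℕ, {x | |g x| ≤ (R : ℝ)}) = Set.univ :=
      Set.eq_univ_of_forall fun x => Set.mem_iUnion.mpr (exists_nat_ge |g x|)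
    have h0 : ν (⋃ R : ℕ, {x | |g x| ≤ (R : ℝ)}) = 0 :=
      measure_iUnion_null fun R => le_antisymm (hcon R) bot_le
    rw [hU] at h0
    simp at h0
  set S := {x | |g x| ≤ (R : ℝ)} with hS
  have hSm : MeasurableSet S := measurableSet_le hcont.abs.measurable measurable_const
  have hSpos : 0 < ν.real S := ENNReal.toReal_pos hR.ne' (measure_ne_top _ _)
  have hmean : ∀ n, m n ^ 2 ≤ (2 * E + 2 * R ^ 2) / ν.real S := by
    intro n
    rw [le_div_iff₀ hSpos]
    have hint : Integrable (fun x => 2 * (φ n (g x) - m n) ^ 2 + 2 * (R : ℝ) ^ 2) ν :=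
      ((hh2 n).integrable_sq.const_mul 2).add (integrable_const _)
    calc m n ^ 2 * ν.real S = ∫ x, S.indicator (fun _ => m n ^ 2) x ∂ν := by
          rw [integral_indicator_const _ hSm, smul_eq_mul, mul_comm]
      _ ≤ ∫ x, (2 * (φ n (g x) - m n) ^ 2 + 2 * (R : ℝ) ^ 2) ∂ν := by
          refine integral_mono ((integrable_const _).indicator hSm) hint fun x => ?_
          by_cases hx : x ∈ S
          · rw [Set.indicator_of_mem hx]
            have h1 : φ n (g x) ^ 2 ≤ (R : ℝ) ^ 2 :=
              sq_le_sq' (abs_le.mp ((hφle n _).trans hx)).1 (abs_le.mp ((hφle n _).trans hx)).2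
            nlinarith [sq_nonneg (2 * φ n (g x) - m n)]
          · rw [Set.indicator_of_notMem hx]
            positivity
      _ ≤ 2 * E + 2 * R ^ 2 := by
          rw [integral_add ((hh2 n).integrable_sq.const_mul 2) (integrable_const _),
            integral_const_mul]
          simp only [integral_const, probReal_univ, one_smul]
          linarith [hvar n]
  set D := 2 * E + 2 * ((2 * E + 2 * R ^ 2) / ν.real S) with hD
  have hbound : ∀ n, ∫ x, φ n (g x) ^ 2 ∂ν ≤ D := by
    intro n
    calc ∫ x, φ n (g x) ^ 2 ∂ν ≤ ∫ x, (2 * (φ n (g x) - m n) ^ 2 + 2 * m n ^ 2) ∂ν := by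
          refine integral_mono (hu2 n).integrable_sq
            (((hh2 n).integrable_sq.const_mul 2).add (integrable_const _)) fun x => ?_
          nlinarith [sq_nonneg (φ n (g x) - 2 * m n)]
      _ ≤ D := by
          rw [integral_add ((hh2 n).integrable_sq.const_mul 2) (integrable_const _),
            integral_const_mul]
          simp only [integral_const, probReal_univ, one_smul]
          linarith [hvar n, hmean n]
  rw [memLp_two_iff_integrable_sq hcont.aestronglyMeasurable]
  refine ⟨(hcont.pow 2).aestronglyMeasurable, ?_⟩
  rw [hasFiniteIntegral_iff_ofReal (ae_of_all _ fun x => sq_nonneg (g x))]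
  calc ∫⁻ x, ENNReal.ofReal (g x ^ 2) ∂ν
      = ∫⁻ x, Filter.liminf (fun n => ENNReal.ofReal (φ n (g x) ^ 2)) Filter.atTop ∂ν := by
        refine lintegral_congr fun x => (Filter.Tendsto.liminf_eq ?_).symm
        exact ENNReal.tendsto_ofReal ((hφlim (g x)).pow 2)
    _ ≤ Filter.liminf (fun n => ∫⁻ x, ENNReal.ofReal (φ n (g x) ^ 2) ∂ν) Filter.atTop :=
        lintegral_liminf_le fun n => ((hcontφ n).pow 2).measurable.ennreal_ofReal
    _ ≤ ENNReal.ofReal D := by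
        refine Filter.liminf_le_of_frequently_le' (Filter.Frequently.of_forall fun n => ?_)
        rw [← ofReal_integral_eq_lintegral_ofReal (hu2 n).integrable_sq
          (ae_of_all _ fun x => sq_nonneg _)]
        exact ENNReal.ofReal_le_ofReal (hbound n)
    _ < ⊤ := ENNReal.ofReal_lt_top

end CarreDuChamp

/-- Approximate integration by parts formula with the eigenfunction `f` itself
(Corollary 3.2). -/
theorem approx_ibp_eigenfunction
    (ν : Measure ℝ) [IsProbabilityMeasure ν]
    (a : ℝ → ℝ) (ha : ∀ x, 0 ≤ a x)
    (k : ℕ) (hk : 1 ≤ k)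
    (f : ℝ → ℝ) (hf : MemH1 a ν f)
    (Λ : ℝ) (hf2 : ∫ x, (f x) ^ 2 ∂ν = 1)
    (hfΓ : ∫ x, a x * (deriv f x) ^ 2 ∂ν ≤ Λ)
    (p : Fin (k - 1) → ℝ → ℝ) (hp : ∀ i, MemH1 a ν (p i))
    (lams : Fin (k - 1) → ℝ) (hlams : ∀ i, 0 < lams i)
    (lam : ℝ) (hlam : 0 < lam)
    (horth : ∀ i j, i ≠ j → ∫ x, p i x * p j x ∂ν = 0)
    (heig : ∀ i, ∀ g, MemH1 a ν g →
      ∫ x, a x * deriv (p i) x * deriv g x ∂ν = lams i * ∫ x, p i x * g x ∂ν)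
    (hperp : ∀ i, ∫ x, (f x - ∑ j, p j x) * p i x ∂ν = 0)
    (hpoinc : ∀ g, MemH1 a ν g → (∀ i, ∫ x, g x * p i x ∂ν = 0) →
      lam * ∫ x, (g x) ^ 2 ∂ν ≤ ∫ x, a x * (deriv g x) ^ 2 ∂ν) :
    ∀ g, MemH1 a ν g → (∀ i, ∫ x, g x * p i x ∂ν = 0) →
      |∫ x, (lam * f x * g x - a x * deriv f x * deriv g x) ∂ν|
        ≤ Real.sqrt (Λ - lam + ∑ i, (lam - lams i) * ∫ x, (p i x) ^ 2 ∂ν)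
          * Real.sqrt (∫ x, a x * (deriv g x) ^ 2 ∂ν) := by
  intro g hg hgp
  have hp2 : ∀ i, MemLp (p i) 2 ν := fun i =>
    memLp_two_of_weak_eigenfunction (hp i) (hlams i) ha (heig i)
  have hf2' : MemLp f 2 ν := by
    rw [memLp_two_iff_integrable_sq hf.1.continuous.aestronglyMeasurable]
    by_contra h
    rw [integral_undef h] at hf2
    exact zero_ne_one hf2
  set L := l2Form a ν ha with hLdef
  set G := energyForm a ν ha with hGdef
  let P : Fin (k - 1) → h1L2 a ν ha := fun i => ⟨p i, hp i, hp2 i⟩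
  let F : h1L2 a ν ha := ⟨f, hf, hf2'⟩
  have hLsq : ∀ u, L u u = ∫ x, u.1 x ^ 2 ∂ν := fun u => by
    simp only [hLdef, l2Form_apply, sq]
  have hGsq : ∀ u, G u u = ∫ x, a x * deriv u.1 x ^ 2 ∂ν := fun u => by
    simp only [hGdef, energyForm_apply, sq, mul_assoc]
  have hL : ∀ u v, L u v = L v u := fun u v =>
    integral_congr_ae (ae_of_all _ fun x => mul_comm _ _)
  have hG : ∀ u v, G u v = G v u := fun u v =>
    integral_congr_ae (ae_of_all _ fun x => mul_right_comm _ _ _)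
  have hL0 : ∀ u, 0 ≤ L u u := fun u => by
    rw [hLsq]
    exact integral_nonneg fun x => sq_nonneg _
  have hG0 : ∀ u, 0 ≤ G u u := fun u => by
    rw [hGsq]
    exact integral_nonneg fun x => mul_nonneg (ha x) (sq_nonneg _)
  have hPorth : ∀ i j, i ≠ j → L (P i) (P j) = 0 := horth
  have hPeig : ∀ i v, G (P i) v = lams i * L (P i) v := fun i v => heig i v.1 v.2.1
  have hpoincV : ∀ v, (∀ i, L v (P i) = 0) → lam * L v v ≤ G v v := fun v hv => by
    rw [hLsq, hGsq]
    exact hpoinc v.1 v.2.1 hv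
  have hg2 : MemLp g 2 ν := by
    refine hg.memLp_two_of_poincare (C := lam⁻¹ + ∑ i, (lams i)⁻¹) ?_ (fun u hu hu2 => ?_) ha
    · exact add_nonneg (inv_pos.mpr hlam).le
        (Finset.sum_nonneg fun i _ => (inv_pos.mpr (hlams i)).le)
    · have := le_mul_of_poincare_orthogonal L G hL hG hL0 hG0 P lams hlams hPorth hPeig lam hlam
        hpoincV ⟨u, hu, hu2⟩
      rwa [hLsq, hGsq] at this
  let g' : h1L2 a ν ha := ⟨g, hg, hg2⟩
  have hFperp : ∀ i, L (F - ∑ j, P j) (P i) = 0 := by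
    intro i
    rw [← hperp i]
    simp only [hLdef, l2Form_apply]
    refine integral_congr_ae (ae_of_all _ fun x => ?_)
    simp [F, P]
  have main := abs_sub_le_sqrt_mul_sqrt_of_poincare_orthogonal L G hL hG hL0 P lams hPorth hPeig
    lam hlam hpoincV F g' Λ (by rw [hLsq, ← hf2]) (by rw [hGsq]; exact hfΓ) hFperp hgp
  simp only [hLsq, hGsq] at main
  convert main using 2
  simp only [hLdef, hGdef, l2Form_apply, energyForm_apply]
  have hfg : Integrable (fun x => f x * g x) ν := hf2'.integrable_mul hg2
  rw [← integral_const_mul, ← integral_sub (hfg.const_mul lam)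
    (integrable_carreDuChamp ha hf.2.2 hg.2.2)]
  exact integral_congr_ae (ae_of_all _ fun x => by simp only [mul_assoc])
end

section
/- Under the hypotheses of the extended approximate integration by parts corollary (ν a probability measure on M, f ∈ H¹(ν) with ∫ f² dν = 1 and ∫ Γ(f) dν ≤ Λ, weak eigenfunctions p₁,…,p_{k−1} ∈ H¹(ν) with positive eigenvalues λ_i ≤ λ, pairwise L²(ν)-orthogonal, ∫ Γ(p_i,g) dν = λ_i ∫ p_i g dν for all g ∈ H¹(ν), ∫ (f − Σ p_j) p_i dν = 0 for all i, and λ ∫ g² dν ≤ ∫ Γ(g) dν for all g ∈ H¹(ν) with ∫ g p_i dν = 0 for all i), assume moreover the full Poincaré inequality: λ_P ∫ g² dν ≤ ∫ Γ(g) dν for every g ∈ H¹(ν), with λ_P > 0. Then for every g ∈ H¹(ν), | ∫ ( Λ f g − Γ(f, g) ) dν | ≤ [ |Λ − λ|^{1/2} + |Λ − λ| / √λ_P + Σ_{i=1}^{k−1} C_i ( ∫ p_i² dν )^{1/2} ] · ( ∫ Γ(g) dν )^{1/2}, where C_i = |λ − λ_i|^{1/2} + (λ − λ_i)/√λ_i.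 -/
open MeasureTheory Real

theorem sqrt_add_le_sqrt_add_sqrt {x y : ℝ} (hx : 0 ≤ x) (hy : 0 ≤ y) :
    √(x + y) ≤ √x + √y := by
  rw [Real.sqrt_le_left (by positivity)]
  nlinarith [Real.sq_sqrt hx, Real.sq_sqrt hy, mul_nonneg (Real.sqrt_nonneg x) (Real.sqrt_nonneg y)]

theorem sqrt_sum_le_sum_sqrt {ι : Type*} [Fintype ι] {x : ι → ℝ} (hx : ∀ i, 0 ≤ x i) :
    √(∑ i, x i) ≤ ∑ i, √(x i) := by
  refine Finset.le_sum_of_subadditive_on_pred (fun t => √t) (fun t => 0 ≤ t) Real.sqrt_zero.le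
    (fun a b ha hb => sqrt_add_le_sqrt_add_sqrt ha hb) (fun a b => add_nonneg) x
    fun i _ => hx i

namespace LinearMap.BilinForm

variable {V ι : Type*} [AddCommGroup V] [Module ℝ V]

theorem abs_apply_le_sqrt_mul_sqrt {B : LinearMap.BilinForm ℝ V} (hB : B.IsSymm)
    (hB0 : ∀ v, 0 ≤ B v v) (v w : V) : |B v w| ≤ √(B v v) * √(B w w) := by
  rw [← Real.sqrt_mul (hB0 v)]
  refine Real.abs_le_sqrt ?_
  rw [sq]
  nth_rewrite 2 [hB.eq]
  exact LinearMap.BilinForm.apply_mul_apply_le_of_forall_zero_le B hB0 v w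

variable [Fintype ι] {L G : LinearMap.BilinForm ℝ V} {p : ι → V} {lams : ι → ℝ} {lam : ℝ}

theorem sum_smul_apply_eq_of_pairwise (horth : ∀ i j, i ≠ j → L (p i) (p j) = 0)
    (c : ι → ℝ) (i : ι) : L (∑ j, c j • p j) (p i) = c i * L (p i) (p i) := by
  rw [map_sum, LinearMap.sum_apply, Finset.sum_eq_single i]
  · simp
  · intro j _ hj
    simp [horth j i hj]
  · simp

/-- If `G` dominates `lam • L` on the `L`-orthogonal complement of a family of eigenvectors,
then `G - lam • L` obeys a Cauchy–Schwarz bound against arbitrary test vectors. -/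
theorem abs_sub_le_of_orthogonal_eigenvectors
    (hL : L.IsSymm) (hG : G.IsSymm) (hL0 : ∀ v, 0 ≤ L v v) (hG0 : ∀ v, 0 ≤ G v v)
    (horth : ∀ i j, i ≠ j → L (p i) (p j) = 0)
    (heig : ∀ i v, G (p i) v = lams i * L (p i) v) (hlam : 0 ≤ lam)
    (hgap : ∀ v, (∀ i, L v (p i) = 0) → lam * L v v ≤ G v v)
    {v : V} (hv : ∀ i, L v (p i) = 0) (g : V) :
    |G v g - lam * L v g| ≤ √(G v v - lam * L v v) * √(G g g) := by
  have hperp : ∀ (c : ι → ℝ) (u : V), (∀ i, L u (p i) = 0) →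
      L u (∑ i, c i • p i) = 0 ∧ G u (∑ i, c i • p i) = 0 := by
    intro c u hu
    refine ⟨by simp [hu], ?_⟩
    rw [map_sum]
    refine Finset.sum_eq_zero fun i _ => ?_
    rw [map_smul, hG.eq u (p i), heig, hL.eq (p i) u, hu, mul_zero, smul_zero]
  set c : ι → ℝ := fun i => L g (p i) / L (p i) (p i) with hc
  set r : V := ∑ i, c i • p i with hr
  set w : V := g - r with hw
  have hgw : g = w + r := by rw [hw, sub_add_cancel]
  have hwp : ∀ i, L w (p i) = 0 := by
    intro i
    rw [hw, map_sub, LinearMap.sub_apply, hr, sum_smul_apply_eq_of_pairwise horth, hc]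
    by_cases hi : L (p i) (p i) = 0
    · have := abs_apply_le_sqrt_mul_sqrt hL hL0 g (p i)
      rw [hi, Real.sqrt_zero, mul_zero, abs_nonpos_iff] at this
      simp [hi, this]
    · simp [div_mul_cancel₀ _ hi]
  have hGg : G w w ≤ G g g := by
    have h1 := (hperp c w hwp).2
    have h2 : G r w = 0 := (hG.eq r w).trans h1
    rw [← hr] at h1
    simp only [hgw, map_add, LinearMap.add_apply, h1, h2]
    linarith [hG0 r]
  let W : Submodule ℝ V :=
    { carrier := {u | ∀ i, L u (p i) = 0}
      add_mem' := fun hx hy i => by simp [hx i, hy i]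
      zero_mem' := fun i => by simp
      smul_mem' := fun s x hx i => by simp [hx i] }
  have hB := abs_apply_le_sqrt_mul_sqrt (B := (G - lam • L).restrict W)
    ⟨fun x y => by simp [hG.eq x.1 y.1, hL.eq x.1 y.1]⟩
    (fun x => by simpa using hgap x.1 x.2) ⟨v, hv⟩ ⟨w, hwp⟩
  simp only [restrict_apply, LinearMap.domRestrict_apply, LinearMap.sub_apply,
    LinearMap.smul_apply, smul_eq_mul] at hB
  have hvg : G v g - lam * L v g = G v w - lam * L v w := by
    rw [hgw, map_add, map_add, (hperp c v hv).1, (hperp c v hv).2, add_zero, add_zero]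
  rw [hvg]
  refine hB.trans (mul_le_mul_of_nonneg_left (Real.sqrt_le_sqrt ?_) (Real.sqrt_nonneg _))
  linarith [mul_nonneg hlam (hL0 w)]

/-- Approximate integration by parts for a pair of positive semidefinite forms. -/
theorem abs_mul_sub_le_of_eigenvectors
    (hL : L.IsSymm) (hG : G.IsSymm) (hL0 : ∀ v, 0 ≤ L v v) (hG0 : ∀ v, 0 ≤ G v v)
    (horth : ∀ i j, i ≠ j → L (p i) (p j) = 0)
    (heig : ∀ i v, G (p i) v = lams i * L (p i) v)
    (hlams : ∀ i, 0 < lams i) (hle : ∀ i, lams i ≤ lam) (hlam : 0 ≤ lam)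
    (hgap : ∀ v, (∀ i, L v (p i) = 0) → lam * L v v ≤ G v v)
    {lamP : ℝ} (hlamP : 0 < lamP) (hpoinc : ∀ v, lamP * L v v ≤ G v v)
    {f : V} {Lam : ℝ} (hf : L f f = 1) (hfG : G f f ≤ Lam)
    (hperp : ∀ i, L (f - ∑ j, p j) (p i) = 0) (g : V) :
    |Lam * L f g - G f g| ≤
      (√|Lam - lam| + |Lam - lam| / √lamP
        + ∑ i, (√|lam - lams i| + (lam - lams i) / √(lams i)) * √(L (p i) (p i)))
      * √(G g g) := by
  set q : V := ∑ j, p j with hq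
  set h : V := f - q with hh
  have hfh : f = h + q := by rw [hh, sub_add_cancel]
  have hLq : ∀ v, L q v = ∑ i, L (p i) v := fun v => by
    rw [hq, map_sum, LinearMap.sum_apply]
  have hGq : ∀ v, G q v = ∑ i, lams i * L (p i) v := fun v => by
    rw [hq, map_sum, LinearMap.sum_apply]; simp_rw [heig]
  have hph : ∀ i, L (p i) h = 0 := fun i => (hL.eq (p i) h).trans (hperp i)
  have hqp : ∀ i, L (p i) q = L (p i) (p i) := fun i => by
    refine (hL.eq (p i) q).trans ?_
    simpa [hq] using sum_smul_apply_eq_of_pairwise horth (fun _ => (1 : ℝ)) i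
  have hLqh : L q h = 0 := by simp [hLq, hph]
  have hGqh : G q h = 0 := by simp [hGq, hph]
  have hLff : L f f = L h h + ∑ i, L (p i) (p i) := by
    have hhq : L h q = 0 := (hL.eq h q).trans hLqh
    rw [hfh]
    simp only [map_add, LinearMap.add_apply, hLqh, hhq, hLq q, hqp]
    ring
  have hGff : G f f = G h h + ∑ i, lams i * L (p i) (p i) := by
    have hhq : G h q = 0 := (hG.eq h q).trans hGqh
    rw [hfh]
    simp only [map_add, LinearMap.add_apply, hGqh, hhq, hGq q, hqp]
    ring
  have hdefect : √(G h h - lam * L h h) ≤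
      √|Lam - lam| + ∑ i, √|lam - lams i| * √(L (p i) (p i)) := by
    have hsum : G h h - lam * L h h ≤
        |Lam - lam| + ∑ i, |lam - lams i| * L (p i) (p i) := by
      have : ∑ i, (lam - lams i) * L (p i) (p i) ≤ ∑ i, |lam - lams i| * L (p i) (p i) :=
        Finset.sum_le_sum fun i _ => mul_le_mul_of_nonneg_right (le_abs_self _) (hL0 _)
      simp only [sub_mul, Finset.sum_sub_distrib, ← Finset.mul_sum] at this
      have hh1 : L h h = 1 - ∑ i, L (p i) (p i) := by linarith
      rw [hh1]
      linarith [le_abs_self (Lam - lam)]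
    refine (Real.sqrt_le_sqrt hsum).trans ((sqrt_add_le_sqrt_add_sqrt (abs_nonneg _) ?_).trans ?_)
    · exact Finset.sum_nonneg fun i _ => mul_nonneg (abs_nonneg _) (hL0 _)
    · refine add_le_add_right ((sqrt_sum_le_sum_sqrt fun i => ?_).trans_eq ?_) _
      · exact mul_nonneg (abs_nonneg _) (hL0 _)
      · simp_rw [Real.sqrt_mul (abs_nonneg _)]
  have hhg := abs_sub_le_of_orthogonal_eigenvectors hL hG hL0 hG0 horth heig hlam hgap hperp g
  have hpg : ∀ i, |L (p i) g| ≤ √(L (p i) (p i)) / √(lams i) * √(G g g) := by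
    intro i
    have := abs_apply_le_sqrt_mul_sqrt hG hG0 (p i) g
    rw [heig, heig, abs_mul, abs_of_pos (hlams i), Real.sqrt_mul (hlams i).le] at this
    have hs := Real.sqrt_pos.2 (hlams i)
    rw [div_mul_eq_mul_div, le_div_iff₀ hs]
    refine le_of_mul_le_mul_left ?_ hs
    rw [mul_left_comm, Real.mul_self_sqrt (hlams i).le]
    linarith
  have hqg : |lam * L q g - G q g| ≤
      (∑ i, (lam - lams i) / √(lams i) * √(L (p i) (p i))) * √(G g g) := by
    rw [hLq, hGq, Finset.mul_sum, ← Finset.sum_sub_distrib, Finset.sum_mul]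
    refine (Finset.abs_sum_le_sum_abs _ _).trans (Finset.sum_le_sum fun i _ => ?_)
    rw [← sub_mul, abs_mul, abs_of_nonneg (sub_nonneg.2 (hle i))]
    refine (mul_le_mul_of_nonneg_left (hpg i) (sub_nonneg.2 (hle i))).trans_eq ?_
    ring
  have hfg : |L f g| ≤ √(G g g) / √lamP := by
    refine (abs_apply_le_sqrt_mul_sqrt hL hL0 f g).trans ?_
    rw [hf, Real.sqrt_one, one_mul, ← Real.sqrt_div' _ hlamP.le]
    exact Real.sqrt_le_sqrt ((le_div_iff₀' hlamP).2 (hpoinc g))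
  have hsplit : Lam * L f g - G f g =
      (Lam - lam) * L f g + (-(G h g - lam * L h g) + (lam * L q g - G q g)) := by
    have h1 : L f g = L h g + L q g := by rw [hfh]; simp
    have h2 : G f g = G h g + G q g := by rw [hfh]; simp
    rw [h1, h2]; ring
  rw [hsplit]
  refine (abs_add_le _ _).trans ((add_le_add_right (abs_add_le _ _) _).trans ?_)
  rw [abs_neg, abs_mul]
  have e1 := mul_le_mul_of_nonneg_left hfg (abs_nonneg (Lam - lam))
  have e2 := hhg.trans (mul_le_mul_of_nonneg_right hdefect (Real.sqrt_nonneg (G g g)))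
  simp only [add_mul, Finset.sum_add_distrib] at e2 hqg ⊢
  rw [← mul_div_assoc, mul_div_right_comm] at e1
  linarith

end LinearMap.BilinForm

theorem integrable_weight_mul_mul {α : Type*} [MeasurableSpace α] {μ : Measure α} {a u v : α → ℝ}
    (ha : ∀ x, 0 ≤ a x) (hu : Measurable u) (hv : Measurable v)
    (hau : Integrable (fun x => a x * u x ^ 2) μ) (hav : Integrable (fun x => a x * v x ^ 2) μ) :
    Integrable (fun x => a x * u x * v x) μ := by
  refine (hau.add hav).mono' ?_ (ae_of_all _ fun x => ?_)
  · have hquot : (fun x => a x * u x * v x) = fun x => a x * u x ^ 2 * (v x / u x) := by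
      funext x
      by_cases hx : u x = 0
      · simp [hx]
      · field_simp
    rw [hquot]
    exact hau.aestronglyMeasurable.mul (hv.div hu).aestronglyMeasurable
  · rw [Real.norm_eq_abs, mul_assoc, abs_mul, abs_of_nonneg (ha x), Pi.add_apply, ← mul_add]
    refine mul_le_mul_of_nonneg_left ?_ (ha x)
    rw [abs_le]
    constructor <;> nlinarith [sq_nonneg (u x + v x), sq_nonneg (u x - v x), sq_nonneg (u x),
      sq_nonneg (v x)]

section SobolevSpace

variable {a : ℝ → ℝ} {ν : Measure ℝ}

theorem tendsto_mul_sin_div (t : ℝ) :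
    Filter.Tendsto (fun n : ℕ => ((n : ℝ) + 1) * Real.sin (t / ((n : ℝ) + 1))) Filter.atTop
      (nhds t) := by
  have hder : HasDerivAt (fun s : ℝ => Real.sin (t * s)) t 0 := by
    simpa using ((hasDerivAt_id (0 : ℝ)).const_mul t).sin
  have hseq : Filter.Tendsto (fun n : ℕ => 1 / ((n : ℝ) + 1)) Filter.atTop
      (nhdsWithin 0 {0}ᶜ) :=
    tendsto_nhdsWithin_iff.2 ⟨tendsto_one_div_add_atTop_nhds_zero_nat,
      Filter.Eventually.of_forall fun n => (Nat.one_div_pos_of_nat (α := ℝ)).ne'⟩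
  refine (hder.tendsto_slope.comp hseq).congr fun n => ?_
  simp [slope_def_field, div_eq_mul_inv, mul_comm]

theorem MemH1.truncate [IsProbabilityMeasure ν] (ha : ∀ x, 0 ≤ a x) {g : ℝ → ℝ}
    (hg : MemH1 a ν g) {c : ℝ} (hc : 0 < c) :
    MemH1 a ν (fun x => c * Real.sin (g x / c) - ∫ y, c * Real.sin (g y / c) ∂ν) ∧
      ∀ x, a x * deriv (fun x => c * Real.sin (g x / c) - ∫ y, c * Real.sin (g y / c) ∂ν) x ^ 2
        ≤ a x * deriv g x ^ 2 := by
  obtain ⟨hg1, -, hgΓ⟩ := hg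
  have hderiv : ∀ x, deriv
      (fun x => c * Real.sin (g x / c) - ∫ y, c * Real.sin (g y / c) ∂ν) x
        = Real.cos (g x / c) * deriv g x := by
    intro x
    have h := ((hg1.differentiable one_ne_zero x).hasDerivAt.div_const c).sin.const_mul c
    rw [(h.sub_const _).deriv]
    field_simp
  have hle : ∀ x, a x * (Real.cos (g x / c) * deriv g x) ^ 2 ≤ a x * deriv g x ^ 2 := by
    intro x
    refine mul_le_mul_of_nonneg_left ?_ (ha x)
    rw [mul_pow]
    exact mul_le_of_le_one_left (sq_nonneg _) (Real.cos_sq_le_one _)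
  have hcont : Continuous fun x => c * Real.sin (g x / c) := by
    have := hg1.continuous
    fun_prop
  have hint : Integrable (fun x => c * Real.sin (g x / c)) ν := by
    refine Integrable.of_bound hcont.aestronglyMeasurable c (ae_of_all _ fun x => ?_)
    rw [Real.norm_eq_abs, abs_mul, abs_of_pos hc]
    exact mul_le_of_le_one_right hc.le (Real.abs_sin_le_one _)
  refine ⟨⟨?_, ?_, ?_⟩, fun x => by rw [hderiv]; exact hle x⟩
  · exact (contDiff_const.mul (hg1.div_const c).sin).sub contDiff_const
  · rw [integral_sub hint (integrable_const _)]
    simp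
  · simp_rw [hderiv]
    refine hgΓ.mono' ?_ (ae_of_all _ fun x => ?_)
    · have := hg1.continuous
      have hcos : Continuous fun x => Real.cos (g x / c) ^ 2 := by fun_prop
      refine (hcos.aestronglyMeasurable.mul hgΓ.aestronglyMeasurable).congr
        (ae_of_all _ fun x => ?_)
      simp only [Pi.mul_apply]
      ring
    · rw [Real.norm_of_nonneg (mul_nonneg (ha x) (sq_nonneg _))]
      exact hle x

theorem memLp_two_of_lintegral_sub_sq_lt_top [IsFiniteMeasure ν] {g : ℝ → ℝ} (hg : Continuous g)
    {y : ℝ} (h : ∫⁻ x, ENNReal.ofReal ((g y - g x) ^ 2) ∂ν < ⊤) : MemLp g 2 ν := by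
  have hcont : Continuous fun x => g y - g x := by fun_prop
  have hsub : MemLp (fun x => g y - g x) 2 ν := by
    rw [memLp_two_iff_integrable_sq hcont.aestronglyMeasurable]
    refine ⟨(hcont.pow 2).aestronglyMeasurable, ?_⟩
    rwa [hasFiniteIntegral_iff_ofReal (ae_of_all _ fun x => sq_nonneg _)]
  have := (memLp_const (μ := ν) (p := 2) (g y)).sub hsub
  simpa [Pi.sub_def] using this

/-- Under a Poincaré inequality, finite energy implies square integrability. -/
theorem MemH1.memLp_two [IsProbabilityMeasure ν] (ha : ∀ x, 0 ≤ a x) {lamP : ℝ} (hlamP : 0 < lamP)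
    (hpoinc : ∀ g, MemH1 a ν g →
      lamP * ∫ x, (g x) ^ 2 ∂ν ≤ ∫ x, a x * (deriv g x) ^ 2 ∂ν)
    {g : ℝ → ℝ} (hg : MemH1 a ν g) : MemLp g 2 ν := by
  have hgc := hg.1.continuous
  set c : ℕ → ℝ := fun n => (n : ℝ) + 1
  have hcpos : ∀ n, 0 < c n := fun n => by positivity
  set u : ℕ → ℝ → ℝ := fun n x => c n * Real.sin (g x / c n)
  set K : ℝ := (∫ x, a x * (deriv g x) ^ 2 ∂ν) / lamP
  have huc : ∀ n, Continuous (u n) := fun n => by fun_prop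
  have hvar : ∀ n, ∫⁻ x, ENNReal.ofReal ((u n x - ∫ y, u n y ∂ν) ^ 2) ∂ν ≤ ENNReal.ofReal K := by
    intro n
    obtain ⟨hmem, hΓ⟩ := hg.truncate ha (hcpos n)
    have hb : Integrable (fun x => (u n x - ∫ y, u n y ∂ν) ^ 2) ν := by
      refine Integrable.of_bound (((huc n).sub continuous_const).pow 2).aestronglyMeasurable
        ((c n + |∫ y, u n y ∂ν|) ^ 2) (ae_of_all _ fun x => ?_)
      rw [norm_pow, Real.norm_eq_abs]
      refine pow_le_pow_left₀ (abs_nonneg _) ((abs_sub _ _).trans (add_le_add_left ?_ _)) 2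
      rw [abs_mul, abs_of_pos (hcpos n)]
      exact mul_le_of_le_one_right (hcpos n).le (Real.abs_sin_le_one _)
    rw [← ofReal_integral_eq_lintegral_ofReal hb (ae_of_all _ fun x => sq_nonneg _)]
    refine ENNReal.ofReal_le_ofReal ((le_div_iff₀' hlamP).2 ?_)
    exact (hpoinc _ hmem).trans (integral_mono hmem.2.2 hg.2.2 hΓ)
  have hpair : ∀ n, ∫⁻ z, ENNReal.ofReal ((u n z.1 - u n z.2) ^ 2) ∂(ν.prod ν) ≤
      2 * ENNReal.ofReal K + 2 * ENNReal.ofReal K := by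
    intro n
    set m := ∫ y, u n y ∂ν
    have hm : Measurable fun x => 2 * ENNReal.ofReal ((u n x - m) ^ 2) := by
      have := huc n
      fun_prop
    have hvar2 : ∫⁻ x, 2 * ENNReal.ofReal ((u n x - m) ^ 2) ∂ν ≤ 2 * ENNReal.ofReal K := by
      rw [lintegral_const_mul' _ _ (by simp)]
      gcongr
      exact hvar n
    calc ∫⁻ z, ENNReal.ofReal ((u n z.1 - u n z.2) ^ 2) ∂(ν.prod ν)
        ≤ ∫⁻ z, (2 * ENNReal.ofReal ((u n z.1 - m) ^ 2)
            + 2 * ENNReal.ofReal ((u n z.2 - m) ^ 2)) ∂(ν.prod ν) := by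
          refine lintegral_mono fun z => ?_
          rw [← mul_add, ← ENNReal.ofReal_add (sq_nonneg _) (sq_nonneg _),
            ← ENNReal.ofReal_ofNat 2, ← ENNReal.ofReal_mul (by norm_num)]
          refine ENNReal.ofReal_le_ofReal ?_
          nlinarith [sq_nonneg (u n z.1 - m + (u n z.2 - m))]
      _ = ∫⁻ x, 2 * ENNReal.ofReal ((u n x - m) ^ 2) ∂ν
            + ∫⁻ x, 2 * ENNReal.ofReal ((u n x - m) ^ 2) ∂ν := by
          rw [lintegral_add_left (f := fun z : ℝ × ℝ => 2 * ENNReal.ofReal ((u n z.1 - m) ^ 2))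
            (hm.comp measurable_fst)]
          rw [measurePreserving_fst.lintegral_comp hm, measurePreserving_snd.lintegral_comp hm]
      _ ≤ _ := add_le_add hvar2 hvar2
  have hfatou : ∫⁻ z, ENNReal.ofReal ((g z.1 - g z.2) ^ 2) ∂(ν.prod ν) < ⊤ := by
    have hlim : ∀ z : ℝ × ℝ, Filter.liminf
        (fun n => ENNReal.ofReal ((u n z.1 - u n z.2) ^ 2)) Filter.atTop
          = ENNReal.ofReal ((g z.1 - g z.2) ^ 2) := fun z =>
      (ENNReal.tendsto_ofReal
        (((tendsto_mul_sin_div (g z.1)).sub (tendsto_mul_sin_div (g z.2))).pow 2)).liminf_eq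
    simp_rw [← hlim]
    refine (lintegral_liminf_le fun n => ?_).trans_lt ?_
    · have := huc n
      fun_prop
    · refine (Filter.liminf_le_of_le (a := 2 * ENNReal.ofReal K + 2 * ENNReal.ofReal K)
        (by isBoundedDefault) fun b hb => ?_).trans_lt (by finiteness)
      obtain ⟨n, hn⟩ := hb.exists
      exact hn.trans (hpair n)
  have hmeas : Measurable fun z : ℝ × ℝ => ENNReal.ofReal ((g z.1 - g z.2) ^ 2) := by fun_prop
  rw [lintegral_prod _ hmeas.aemeasurable] at hfatou
  obtain ⟨y, hy⟩ := (ae_lt_top hmeas.lintegral_prod_right' hfatou.ne).exists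
  exact memLp_two_of_lintegral_sub_sq_lt_top hgc hy

variable (a ν) in
/-- The square-integrable members of `H¹(ν)` as a vector space. -/
def h1Submodule [IsFiniteMeasure ν] (ha : ∀ x, 0 ≤ a x) : Submodule ℝ (ℝ → ℝ) where
  carrier := {g | MemH1 a ν g ∧ MemLp g 2 ν}
  zero_mem' := by
    refine ⟨⟨contDiff_const, by simp, ?_⟩, MemLp.zero⟩
    simp
  add_mem' := by
    rintro u v ⟨⟨hu1, hu0, huΓ⟩, hu2⟩ ⟨⟨hv1, hv0, hvΓ⟩, hv2⟩
    refine ⟨⟨hu1.add hv1, ?_, ?_⟩, hu2.add hv2⟩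
    · simp only [Pi.add_apply]
      rw [integral_add (hu2.integrable one_le_two) (hv2.integrable one_le_two), hu0, hv0, add_zero]
    · have huv := integrable_weight_mul_mul ha (measurable_deriv u) (measurable_deriv v) huΓ hvΓ
      refine ((huΓ.add hvΓ).add (huv.const_mul 2)).congr (ae_of_all _ fun x => ?_)
      simp only [Pi.add_apply]
      rw [deriv_add (hu1.differentiable one_ne_zero x) (hv1.differentiable one_ne_zero x)]
      ring
  smul_mem' := by
    rintro s u ⟨⟨hu1, hu0, huΓ⟩, hu2⟩
    refine ⟨⟨contDiff_const.smul hu1, ?_, ?_⟩, hu2.const_smul s⟩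
    · simp [integral_const_mul, hu0]
    · refine (huΓ.const_mul (s ^ 2)).congr (ae_of_all _ fun x => ?_)
      simp only [deriv_const_smul s (hu1.differentiable one_ne_zero x), smul_eq_mul]
      ring

namespace h1Submodule

variable [IsFiniteMeasure ν] (ha : ∀ x, 0 ≤ a x)

theorem differentiableAt (u : h1Submodule a ν ha) (x : ℝ) : DifferentiableAt ℝ u.1 x :=
  u.2.1.1.differentiable one_ne_zero x

theorem integrable_mul (u v : h1Submodule a ν ha) : Integrable (fun x => u.1 x * v.1 x) ν :=
  u.2.2.integrable_mul v.2.2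

theorem integrable_energy (u v : h1Submodule a ν ha) :
    Integrable (fun x => a x * deriv u.1 x * deriv v.1 x) ν :=
  integrable_weight_mul_mul ha (measurable_deriv _) (measurable_deriv _) u.2.1.2.2 v.2.1.2.2

/-- The `L²(ν)` inner product as a bilinear form. -/
noncomputable def innerForm : LinearMap.BilinForm ℝ (h1Submodule a ν ha) :=
  LinearMap.mk₂ ℝ (fun u v => ∫ x, u.1 x * v.1 x ∂ν)
    (fun u v w => by
      rw [← integral_add (integrable_mul ha u w) (integrable_mul ha v w)]
      simp [add_mul])
    (fun s u w => by
      rw [smul_eq_mul, ← integral_const_mul]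
      simp [mul_assoc])
    (fun u v w => by
      rw [← integral_add (integrable_mul ha u v) (integrable_mul ha u w)]
      simp [mul_add])
    (fun s u w => by
      rw [smul_eq_mul, ← integral_const_mul]
      simp [mul_left_comm])

/-- The Dirichlet form `∫ Γ(u, v) dν`. -/
noncomputable def energyForm : LinearMap.BilinForm ℝ (h1Submodule a ν ha) :=
  LinearMap.mk₂ ℝ (fun u v => ∫ x, a x * deriv u.1 x * deriv v.1 x ∂ν)
    (fun u v w => by
      rw [← integral_add (integrable_energy ha u w) (integrable_energy ha v w)]
      refine integral_congr_ae (ae_of_all _ fun x => ?_)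
      simp only [Submodule.coe_add]
      rw [deriv_add (differentiableAt ha u x) (differentiableAt ha v x)]
      ring)
    (fun s u w => by
      rw [smul_eq_mul, ← integral_const_mul]
      refine integral_congr_ae (ae_of_all _ fun x => ?_)
      simp only [Submodule.coe_smul]
      rw [deriv_const_smul s (differentiableAt ha u x), smul_eq_mul]
      ring)
    (fun u v w => by
      rw [← integral_add (integrable_energy ha u v) (integrable_energy ha u w)]
      refine integral_congr_ae (ae_of_all _ fun x => ?_)
      simp only [Submodule.coe_add]
      rw [deriv_add (differentiableAt ha v x) (differentiableAt ha w x)]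
      ring)
    (fun s u w => by
      rw [smul_eq_mul, ← integral_const_mul]
      refine integral_congr_ae (ae_of_all _ fun x => ?_)
      simp only [Submodule.coe_smul]
      rw [deriv_const_smul s (differentiableAt ha w x), smul_eq_mul]
      ring)

theorem innerForm_apply (u v : h1Submodule a ν ha) :
    innerForm ha u v = ∫ x, u.1 x * v.1 x ∂ν := rfl

theorem energyForm_apply (u v : h1Submodule a ν ha) :
    energyForm ha u v = ∫ x, a x * deriv u.1 x * deriv v.1 x ∂ν := rfl

theorem innerForm_self (u : h1Submodule a ν ha) : innerForm ha u u = ∫ x, u.1 x ^ 2 ∂ν := by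
  simp_rw [innerForm_apply, sq]

theorem energyForm_self (u : h1Submodule a ν ha) :
    energyForm ha u u = ∫ x, a x * deriv u.1 x ^ 2 ∂ν := by
  simp_rw [energyForm_apply, sq, mul_assoc]

theorem innerForm_isSymm : (innerForm (ν := ν) ha).IsSymm :=
  ⟨fun u v => by simp_rw [innerForm_apply, mul_comm]⟩

theorem energyForm_isSymm : (energyForm (ν := ν) ha).IsSymm :=
  ⟨fun u v => by simp_rw [energyForm_apply, mul_right_comm]⟩

end h1Submodule

end SobolevSpace

/-- The key inequality (5.2): approximate integration by parts with the reference
eigenvalue `Λ`, using the full Poincaré inequality of `ν`. -/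
theorem approx_ibp_reference_eigenvalue
    (ν : Measure ℝ) [IsProbabilityMeasure ν]
    (a : ℝ → ℝ) (ha : ∀ x, 0 ≤ a x)
    (k : ℕ) (hk : 1 ≤ k)
    (f : ℝ → ℝ) (hf : MemH1 a ν f)
    (Λ : ℝ) (hf2 : ∫ x, (f x) ^ 2 ∂ν = 1)
    (hfΓ : ∫ x, a x * (deriv f x) ^ 2 ∂ν ≤ Λ)
    (p : Fin (k - 1) → ℝ → ℝ) (hp : ∀ i, MemH1 a ν (p i))
    (lams : Fin (k - 1) → ℝ) (hlams : ∀ i, 0 < lams i)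
    (lam : ℝ) (hlam : 0 < lam)
    (hle : ∀ i, lams i ≤ lam)
    (horth : ∀ i j, i ≠ j → ∫ x, p i x * p j x ∂ν = 0)
    (heig : ∀ i, ∀ g, MemH1 a ν g →
      ∫ x, a x * deriv (p i) x * deriv g x ∂ν = lams i * ∫ x, p i x * g x ∂ν)
    (hperp : ∀ i, ∫ x, (f x - ∑ j, p j x) * p i x ∂ν = 0)
    (hpoinc : ∀ g, MemH1 a ν g → (∀ i, ∫ x, g x * p i x ∂ν = 0) →
      lam * ∫ x, (g x) ^ 2 ∂ν ≤ ∫ x, a x * (deriv g x) ^ 2 ∂ν)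
    (lamP : ℝ) (hlamP : 0 < lamP)
    (hfullpoinc : ∀ g, MemH1 a ν g →
      lamP * ∫ x, (g x) ^ 2 ∂ν ≤ ∫ x, a x * (deriv g x) ^ 2 ∂ν) :
    ∀ g, MemH1 a ν g →
      |∫ x, (Λ * f x * g x - a x * deriv f x * deriv g x) ∂ν|
        ≤ (Real.sqrt |Λ - lam| + |Λ - lam| / Real.sqrt lamP
            + ∑ i, (Real.sqrt |lam - lams i| + (lam - lams i) / Real.sqrt (lams i))
                * Real.sqrt (∫ x, (p i x) ^ 2 ∂ν))
          * Real.sqrt (∫ x, a x * (deriv g x) ^ 2 ∂ν) := by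
  intro g hg
  have hL2 : ∀ {u}, MemH1 a ν u → MemLp u 2 ν := fun hu => hu.memLp_two ha hlamP hfullpoinc
  set L := h1Submodule.innerForm (ν := ν) ha
  set G := h1Submodule.energyForm (ν := ν) ha
  let F : h1Submodule a ν ha := ⟨f, hf, hL2 hf⟩
  let g' : h1Submodule a ν ha := ⟨g, hg, hL2 hg⟩
  let P : Fin (k - 1) → h1Submodule a ν ha := fun i => ⟨p i, hp i, hL2 (hp i)⟩
  have key := LinearMap.BilinForm.abs_mul_sub_le_of_eigenvectors
    (L := L) (G := G) (p := P) (lams := lams) (lam := lam) (lamP := lamP) (f := F) (Lam := Λ)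
    (h1Submodule.innerForm_isSymm ha) (h1Submodule.energyForm_isSymm ha)
    (fun v => (h1Submodule.innerForm_self ha v).symm ▸ integral_nonneg fun x => sq_nonneg _)
    (fun v => (h1Submodule.energyForm_self ha v).symm ▸
      integral_nonneg fun x => mul_nonneg (ha x) (sq_nonneg _))
    horth (fun i v => heig i v.1 v.2.1) hlams hle hlam.le
    (fun v hv => by
      rw [h1Submodule.innerForm_self, h1Submodule.energyForm_self]
      exact hpoinc v.1 v.2.1 hv)
    hlamP
    (fun v => by
      rw [h1Submodule.innerForm_self, h1Submodule.energyForm_self]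
      exact hfullpoinc v.1 v.2.1)
    ((h1Submodule.innerForm_self ha F).trans hf2)
    ((h1Submodule.energyForm_self ha F).trans_le hfΓ)
    (fun i => by
      rw [h1Submodule.innerForm_apply]
      simpa [F, P] using hperp i)
    g'
  have hlhs : ∫ x, (Λ * f x * g x - a x * deriv f x * deriv g x) ∂ν = Λ * L F g' - G F g' := by
    rw [h1Submodule.innerForm_apply, h1Submodule.energyForm_apply, ← integral_const_mul,
      ← integral_sub ((h1Submodule.integrable_mul ha F g').const_mul Λ)
        (h1Submodule.integrable_energy ha F g')]
    simp only [F, g', mul_assoc]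
  rw [hlhs]
  simpa only [L, G, h1Submodule.innerForm_self, h1Submodule.energyForm_self, P, g'] using key
end

section
/- Let M ⊆ ℝ be an interval, a : M → ℝ continuous with a > 0 on the interior of M, Γ(f,g)(x) = a(x) f′(x) g′(x), and let λ > 0. Let f : M → ℝ be C¹ with finitely many critical points x₁ < … < x_m in the interior of M, let J₀, …, J_m be the open connected components of the interior of M minus {x₁,…,x_m}, assume f is strictly monotone on each J_j, and set I_j := f(J_j) and h_j := (a·(f′)²) ∘ (f|_{J_j})^{−1} on I_j. Let μ, ν be probability measures on M with μ(J_j) > 0 for all j, and set μ_j* := μ(J_j)^{−1} · (f|_{J_j})_# (μ restricted to J_j) and ν_j* := ν(J_j)^{−1} · (f|_{J_j})_# (ν restricted to J_j) (when ν(J_j) > 0). Assume: (i) there is ε ≥ 0 such that for every function g : M → ℝ which is differentiable on each J_j with ∫ a (g′)² dν < ∞, one has | ∫ ( λ f g − a f′ g′ ) dν | ≤ ε (∫ a (g′)² dν)^{1/2}; (ii) there are constants C_j ≥ 0 such that for every bounded 1-Lipschitz C¹ function g_j : I_j → ℝ there exists a C¹ function ψ_j : I_j → ℝ satisfying h_j(t)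 ψ_j′(t) − λ t ψ_j(t) = g_j(t) − ∫ g_j dμ_j* for all t ∈ I_j, together with sup_{I_j} √(h_j) |ψ_j′| ≤ C_j. Then for every family (g_j)_{j=0}^m of bounded 1-Lipschitz C¹ functions g_j : I_j → ℝ, | Σ_j ν(J_j) ( ∫ g_j dν_j* − ∫ g_j dμ_j* ) | ≤ ( Σ_j C_j² )^{1/2} · ε. -/
open MeasureTheory Real Set

/-- The integral of `g` against the normalised pushforward of `ν` restricted to `J`, weighted by
the mass of `J`, is the integral of `g ∘ f` over `J`. -/
lemma toReal_mul_integral_smul_map_restrict {J : Set ℝ} (hJ : IsOpen J) (hJc : IsPreconnected J)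
    {f g : ℝ → ℝ} (hf : ContinuousOn f J) (hg : ContinuousOn g (f '' J))
    (ν : Measure ℝ) [IsFiniteMeasure ν] :
    (ν J).toReal * ∫ t, g t ∂((ν J)⁻¹ • (ν.restrict J).map f) = ∫ y in J, g (f y) ∂ν := by
  have hfm : AEMeasurable f (ν.restrict J) := hf.aemeasurable hJ.measurableSet
  have himage : MeasurableSet (f '' J) := (hJc.image f hf).ordConnected.measurableSet
  have hae : ∀ᵐ t ∂((ν.restrict J).map f), t ∈ f '' J := by
    refine (ae_map_iff hfm himage).2 ?_
    filter_upwards [ae_restrict_mem hJ.measurableSet] with y hy using mem_image_of_mem f hy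
  have hgm : AEStronglyMeasurable g ((ν.restrict J).map f) := by
    rw [← Measure.restrict_eq_self_of_ae_mem hae]
    exact hg.aestronglyMeasurable himage
  rw [integral_smul_measure, integral_map hfm hgm, smul_eq_mul, ENNReal.toReal_inv]
  by_cases h0 : ν J = 0
  · simp [h0, Measure.restrict_eq_zero.2 h0]
  · have : (ν J).toReal ≠ 0 := ENNReal.toReal_ne_zero.2 ⟨h0, measure_ne_top ν J⟩
    rw [← mul_assoc, mul_inv_cancel₀ this, one_mul]

/-- The chain rule for a `C¹` function on the image of a `C¹` function without critical points. -/
lemma hasDerivAt_comp_of_contDiffOn_image {J : Set ℝ} (hJ : IsOpen J) {f ψ : ℝ → ℝ}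
    (hf : ContDiffOn ℝ 1 f J) (hψ : ContDiffOn ℝ 1 ψ (f '' J)) {y : ℝ} (hy : y ∈ J)
    (hf' : deriv f y ≠ 0) :
    HasDerivAt (fun z => ψ (f z)) (deriv ψ (f y) * deriv f y) y := by
  have hfs : HasStrictDerivAt f (deriv f y) y :=
    (hf.contDiffAt (hJ.mem_nhds hy)).hasStrictDerivAt one_ne_zero
  have himage : f '' J ∈ nhds (f y) := by
    rw [← hfs.map_nhds_eq hf']
    exact Filter.image_mem_map (hJ.mem_nhds hy)
  exact ((hψ.contDiffAt himage).differentiableAt one_ne_zero).hasDerivAt.comp y hfs.hasDerivAt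

/-- Two functions that agree off a countable set but differ at a point cannot both be continuous
there. -/
lemma eq_of_continuousAt_of_eqOn_compl_countable {s : Set ℝ} (hs : s.Countable) {g h : ℝ → ℝ}
    (hgh : EqOn g h sᶜ) {p : ℝ} (hg : ContinuousAt g p) (hh : ContinuousAt h p) : g p = h p := by
  have : (nhdsWithin p sᶜ).NeBot :=
    mem_closure_iff_nhdsWithin_neBot.1 ((hs.dense_compl ℝ) p)
  refine tendsto_nhds_unique (l := nhdsWithin p sᶜ) (hg.tendsto.mono_left nhdsWithin_le_nhds)
    ((hh.tendsto.mono_left nhdsWithin_le_nhds).congr' ?_)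
  filter_upwards [self_mem_nhdsWithin] with z hz using (hgh hz).symm

/-- A real affine function bounded in absolute value off a finite set has its constant term
bounded in the same way. -/
lemma abs_le_of_forall_notMem_finite {S : Set ℝ} (hS : S.Finite) {A K B : ℝ}
    (h : ∀ c ∉ S, |A + c * K| ≤ B) : |A| ≤ B := by
  have hclosed : IsClosed {c : ℝ | |A + c * K| ≤ B} :=
    isClosed_le (by fun_prop) continuous_const
  have hmem : (0 : ℝ) ∈ {c : ℝ | |A + c * K| ≤ B} :=
    closure_minimal (fun c hc => h c hc) hclosed (hS.countable.dense_compl ℝ 0)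
  simpa using hmem

/-- The function equal to `ψ j ∘ f` on `J j`, to `c` on `S`, to `1` off `M`, and to `0` at the
remaining points. -/
noncomputable def gluedTestFunction {ι : Type*} [Fintype ι] (M S : Set ℝ) (J : ι → Set ℝ)
    (f : ℝ → ℝ) (ψ : ι → ℝ → ℝ) (c : ℝ) (y : ℝ) : ℝ :=
  ∑ j, (J j).indicator (fun z => ψ j (f z)) y + S.indicator (fun _ => c) y
    + Mᶜ.indicator (fun _ => 1) y

lemma sum_indicator_eq_of_mem {ι : Type*} [Fintype ι] {J : ι → Set ℝ}
    (hJ : Pairwise (Function.onFun Disjoint J)) (φ : ι → ℝ → ℝ) {j : ι} {y : ℝ} (hy : y ∈ J j) :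
    ∑ i, (J i).indicator (φ i) y = φ j y := by
  rw [Finset.sum_eq_single j, indicator_of_mem hy]
  · intro i _ hij
    exact indicator_of_notMem (disjoint_right.1 (hJ hij) hy) _
  · simp

lemma sum_indicator_eq_zero {ι : Type*} [Fintype ι] {J : ι → Set ℝ} (φ : ι → ℝ → ℝ) {y : ℝ}
    (hy : ∀ j, y ∉ J j) : ∑ i, (J i).indicator (φ i) y = 0 :=
  Finset.sum_eq_zero fun i _ => indicator_of_notMem (hy i) _


/-- Main stability theorem (Theorem 4.1 / 1.2), modular form: the approximate
integration by parts inequality (i) together with the Stein-solution bounds (ii)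
yield a bound on the weighted sum of 1-Wasserstein distances (in dual form)
between the conditional pushforwards of `ν` and `μ` by `f` on the nodal
components `J j`. -/
theorem main_stability
    (M : Set ℝ) (hM : M.OrdConnected)
    (a : ℝ → ℝ) (ha_cont : ContinuousOn a M) (ha_pos : ∀ y ∈ interior M, 0 < a y)
    (lam : ℝ) (hlam : 0 < lam)
    (f : ℝ → ℝ) (hf : ContDiffOn ℝ 1 f M)
    (m : ℕ) (x : Fin m → ℝ) (hx : StrictMono x) (hxM : ∀ i, x i ∈ interior M)
    (hcrit : ∀ y ∈ interior M, (deriv f y = 0 ↔ ∃ i, y = x i))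
    (J : Fin (m + 1) → Set ℝ)
    (hJopen : ∀ j, IsOpen (J j)) (hJconn : ∀ j, IsPreconnected (J j))
    (hJdisj : Pairwise (Function.onFun Disjoint J))
    (hJcover : (⋃ j, J j) = interior M \ Set.range x)
    (hmono : ∀ j, StrictMonoOn f (J j) ∨ StrictAntiOn f (J j))
    (μ ν : Measure ℝ) [IsProbabilityMeasure μ] [IsProbabilityMeasure ν]
    (hμM : μ Mᶜ = 0) (hνM : ν Mᶜ = 0)
    (hμJ : ∀ j, 0 < μ (J j))
    (ε : ℝ) (hε : 0 ≤ ε)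
    (hIPP : ∀ g : ℝ → ℝ, (∀ j, DifferentiableOn ℝ g (J j)) →
      Integrable (fun y => a y * (deriv g y) ^ 2) ν →
      |∫ y, (lam * f y * g y - a y * deriv f y * deriv g y) ∂ν|
        ≤ ε * Real.sqrt (∫ y, a y * (deriv g y) ^ 2 ∂ν))
    (C : Fin (m + 1) → ℝ) (hC : ∀ j, 0 ≤ C j)
    (hStein : ∀ j, ∀ gj : ℝ → ℝ,
      (∃ B, ∀ t ∈ f '' J j, |gj t| ≤ B) →
      LipschitzOnWith 1 gj (f '' J j) →
      ContDiffOn ℝ 1 gj (f '' J j) →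
      ∃ ψ : ℝ → ℝ, ContDiffOn ℝ 1 ψ (f '' J j) ∧
        (∀ y ∈ J j,
          a y * (deriv f y) ^ 2 * deriv ψ (f y) - lam * f y * ψ (f y)
            = gj (f y) - ∫ t, gj t ∂((μ (J j))⁻¹ • (μ.restrict (J j)).map f)) ∧
        (∀ y ∈ J j, Real.sqrt (a y * (deriv f y) ^ 2) * |deriv ψ (f y)| ≤ C j)) :
    ∀ g : Fin (m + 1) → ℝ → ℝ,
      (∀ j, (∃ B, ∀ t ∈ f '' J j, |g j t| ≤ B) ∧ LipschitzOnWith 1 (g j) (f '' J j)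
        ∧ ContDiffOn ℝ 1 (g j) (f '' J j)) →
      |∑ j, (ν (J j)).toReal *
          ((∫ t, g j t ∂((ν (J j))⁻¹ • (ν.restrict (J j)).map f))
            - ∫ t, g j t ∂((μ (J j))⁻¹ • (μ.restrict (J j)).map f))|
        ≤ Real.sqrt (∑ j, (C j) ^ 2) * ε := by
  intro g hg
  choose ψ hψ hψeq hψbd using fun j => hStein j (g j) (hg j).1 (hg j).2.1 (hg j).2.2
  have hJint : ∀ {j y}, y ∈ J j → y ∈ interior M ∧ y ∉ range x := fun {j y} hy =>
    hJcover.subset (mem_iUnion_of_mem j hy)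
  have hJM : ∀ j, J j ⊆ M := fun j y hy => interior_subset (hJint hy).1
  have hf' : ∀ {j y}, y ∈ J j → deriv f y ≠ 0 := fun {j y} hy h0 => by
    obtain ⟨i, hi⟩ := (hcrit y (hJint hy).1).1 h0
    exact (hJint hy).2 ⟨i, hi.symm⟩
  have hνae : ∀ᵐ y ∂ν, y ∈ M := by simpa [ae_iff, compl_def] using hνM
  set G : ℝ → ℝ → ℝ := gluedTestFunction M (range x) J f ψ with hG
  have hGJ : ∀ c, ∀ {j y}, y ∈ J j → G c y = ψ j (f y) := fun c {j y} hy => by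
    simp only [hG, gluedTestFunction]
    rw [sum_indicator_eq_of_mem hJdisj (fun j z => ψ j (f z)) hy,
      indicator_of_notMem (hJint hy).2, indicator_of_notMem (by simpa using hJM j hy)]
    ring
  have hGx : ∀ c i, G c (x i) = c := fun c i => by
    simp only [hG, gluedTestFunction]
    rw [sum_indicator_eq_zero (fun j z => ψ j (f z)) fun j hj => (hJint hj).2 ⟨i, rfl⟩,
      indicator_of_mem (mem_range_self i), indicator_of_notMem (by simpa using interior_subset (hxM i))]
    ring
  have hGbd : ∀ c, ∀ y ∈ M \ interior M, G c y = 0 := fun c y hy => by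
    simp only [hG, gluedTestFunction]
    rw [sum_indicator_eq_zero (fun j z => ψ j (f z)) fun j hj => hy.2 (hJint hj).1,
      indicator_of_notMem (by rintro ⟨i, rfl⟩; exact hy.2 (hxM i)),
      indicator_of_notMem (by simpa using hy.1)]
    ring
  have hGout : ∀ c, ∀ y ∈ Mᶜ, G c y = 1 := fun c y hy => by
    simp only [hG, gluedTestFunction]
    rw [sum_indicator_eq_zero (fun j z => ψ j (f z)) fun j hj => hy (hJM j hj),
      indicator_of_notMem (by rintro ⟨i, rfl⟩; exact hy (interior_subset (hxM i))),
      indicator_of_mem hy]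
    ring
  have hGderiv : ∀ c, ∀ {j y}, y ∈ J j → HasDerivAt (G c) (deriv (ψ j) (f y) * deriv f y) y :=
    fun c {j y} hy => (hasDerivAt_comp_of_contDiffOn_image (hJopen j) (hf.mono (hJM j)) (hψ j) hy
      (hf' hy)).congr_of_eventuallyEq <| by
        filter_upwards [(hJopen j).mem_nhds hy] with z hz using hGJ c hz
  have hGderiv_bd : ∀ c, ∀ y ∈ M \ interior M, deriv (G c) y = 0 := fun c y hy => by
    refine deriv_zero_of_not_differentiableAt fun hd => ?_
    have hfreq : ∃ᶠ z in nhds y, z ∈ Mᶜ := by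
      rw [← mem_closure_iff_frequently, closure_compl]
      exact hy.2
    have hlt : ∀ᶠ z in nhds y, G c z < 1 :=
      hd.continuousAt.eventually (gt_mem_nhds (by rw [hGbd c y hy]; exact one_pos))
    obtain ⟨z, hz, hz'⟩ := (hfreq.and_eventually hlt).exists
    exact hz'.ne (hGout c z hz)
  set S : Set ℝ := ⋃ i, {c | ContinuousAt (G c) (x i)}
  have hSfin : S.Finite := by
    refine finite_iUnion fun i => Set.Subsingleton.finite fun c hc c' hc' => ?_
    rw [← hGx c i, ← hGx c' i]
    refine eq_of_continuousAt_of_eqOn_compl_countable (finite_range x).countable ?_ hc hc'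
    intro z hz
    simp only [hG, gluedTestFunction, indicator_of_notMem hz]
  have hGderiv_x : ∀ c ∉ S, ∀ i, deriv (G c) (x i) = 0 := fun c hc i =>
    deriv_zero_of_not_differentiableAt fun hd => hc (mem_iUnion_of_mem i hd.continuousAt)
  have hMcases : ∀ y ∈ M, (∃ j, y ∈ J j) ∨ (∃ i, x i = y) ∨ y ∈ M \ interior M := fun y hy => by
    by_cases hyi : y ∈ interior M
    · by_cases hyx : y ∈ range x
      · exact Or.inr (Or.inl hyx)
      · exact Or.inl (mem_iUnion.1 (hJcover.superset ⟨hyi, hyx⟩))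
    · exact Or.inr (Or.inr ⟨hy, hyi⟩)
  have hsum_nonneg : 0 ≤ ∑ j, C j ^ 2 := Finset.sum_nonneg fun j _ => sq_nonneg _
  have henergy : ∀ c ∉ S, ∀ y ∈ M,
      0 ≤ a y * deriv (G c) y ^ 2 ∧ a y * deriv (G c) y ^ 2 ≤ ∑ j, C j ^ 2 := by
    intro c hc y hy
    rcases hMcases y hy with ⟨j, hj⟩ | ⟨i, rfl⟩ | hb
    · have ha := (ha_pos y (hJint hj).1).le
      refine ⟨by positivity, ?_⟩
      calc a y * deriv (G c) y ^ 2
          = (Real.sqrt (a y * deriv f y ^ 2) * |deriv (ψ j) (f y)|) ^ 2 := by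
            rw [(hGderiv c hj).deriv, mul_pow (Real.sqrt _), Real.sq_sqrt (by positivity), sq_abs]
            ring
        _ ≤ C j ^ 2 := by
            gcongr
            exact hψbd j y hj
        _ ≤ ∑ j, C j ^ 2 :=
            Finset.single_le_sum (f := fun j => C j ^ 2) (fun j _ => sq_nonneg _)
              (Finset.mem_univ j)
    · simpa [hGderiv_x c hc i] using hsum_nonneg
    · simpa [hGderiv_bd c y hb] using hsum_nonneg
  have ham : AEStronglyMeasurable a ν := by
    rw [← Measure.restrict_eq_self_of_ae_mem hνae]
    exact ha_cont.aestronglyMeasurable hM.measurableSet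
  have henergy_int : ∀ c ∉ S, Integrable (fun y => a y * deriv (G c) y ^ 2) ν := by
    intro c hc
    refine Integrable.of_bound
      (ham.mul ((measurable_deriv (G c)).pow_const 2).aestronglyMeasurable) (∑ j, C j ^ 2) ?_
    filter_upwards [hνae] with y hy
    rw [Real.norm_of_nonneg (henergy c hc y hy).1]
    exact (henergy c hc y hy).2
  have henergy_le : ∀ c ∉ S, ∫ y, a y * deriv (G c) y ^ 2 ∂ν ≤ ∑ j, C j ^ 2 := by
    intro c hc
    calc ∫ y, a y * deriv (G c) y ^ 2 ∂ν ≤ ∫ _, ∑ j, C j ^ 2 ∂ν :=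
          integral_mono_ae (henergy_int c hc) (integrable_const _) <| by
            filter_upwards [hνae] with y hy using (henergy c hc y hy).2
      _ = ∑ j, C j ^ 2 := by simp
  set k : Fin (m + 1) → ℝ := fun j =>
    ∫ t, g j t ∂((μ (J j))⁻¹ • (μ.restrict (J j)).map f)
  have hfJ : ∀ j, ContinuousOn f (J j) := fun j => hf.continuousOn.mono (hJM j)
  have hgint : ∀ j, IntegrableOn (fun y => g j (f y)) (J j) ν := by
    intro j
    obtain ⟨B, hB⟩ := (hg j).1
    refine Integrable.of_bound (((hg j).2.2.continuousOn.comp (hfJ j)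
      (mapsTo_image f (J j))).aestronglyMeasurable (hJopen j).measurableSet) B ?_
    filter_upwards [ae_restrict_mem (hJopen j).measurableSet] with y hy
      using hB _ (mem_image_of_mem f hy)
  have hterm : ∀ j, (ν (J j)).toReal *
      ((∫ t, g j t ∂((ν (J j))⁻¹ • (ν.restrict (J j)).map f)) - k j)
        = ∫ y in J j, (g j (f y) - k j) ∂ν := by
    intro j
    rw [mul_sub, toReal_mul_integral_smul_map_restrict (hJopen j) (hJconn j) (hfJ j)
      (hg j).2.2.continuousOn, integral_sub (hgint j) (integrable_const _)]
    simp [Measure.real]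
  have hkey : ∀ c ∉ S, ∫ y, (lam * f y * G c y - a y * deriv f y * deriv (G c) y) ∂ν
      = -(∑ j, ∫ y in J j, (g j (f y) - k j) ∂ν)
        + c * ∑ i, ν.real {x i} * (lam * f (x i)) := by
    intro c hc
    have hpt : ∀ᵐ y ∂ν, lam * f y * G c y - a y * deriv f y * deriv (G c) y
        = -(∑ j, (J j).indicator (fun z => g j (f z) - k j) y)
          + c * ∑ i, ({x i} : Set ℝ).indicator (fun _ => lam * f (x i)) y := by
      have hxdisj : Pairwise (Function.onFun Disjoint fun i => ({x i} : Set ℝ)) :=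
        fun i i' hii => disjoint_singleton.2 (hx.injective.ne hii)
      filter_upwards [hνae] with y hy
      rcases hMcases y hy with ⟨j, hj⟩ | ⟨i, rfl⟩ | hb
      · rw [sum_indicator_eq_of_mem hJdisj (fun j z => g j (f z) - k j) hj,
          sum_indicator_eq_zero (J := fun i => {x i}) (fun i _ => lam * f (x i))
            fun i hi => (hJint hj).2 ⟨i, (mem_singleton_iff.1 hi).symm⟩,
          hGJ c hj, (hGderiv c hj).deriv, ← hψeq j y hj]
        ring
      · rw [sum_indicator_eq_zero (fun j z => g j (f z) - k j) fun j hj => (hJint hj).2 ⟨i, rfl⟩,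
          sum_indicator_eq_of_mem (J := fun i => {x i}) hxdisj (fun i _ => lam * f (x i))
            (mem_singleton (x i)), hGx, hGderiv_x c hc]
        ring
      · rw [sum_indicator_eq_zero (fun j z => g j (f z) - k j) fun j hj => hb.2 (hJint hj).1,
          sum_indicator_eq_zero (J := fun i => {x i}) (fun i _ => lam * f (x i))
            fun i hi => hb.2 (by rw [mem_singleton_iff.1 hi]; exact hxM i), hGbd c y hb, hGderiv_bd c y hb]
        ring
    have hi₁ : ∀ j ∈ Finset.univ,
        Integrable ((J j).indicator fun z => g j (f z) - k j) ν := fun j _ =>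
      (integrable_indicator_iff (hJopen j).measurableSet).2
        ((hgint j).sub (integrable_const _))
    have hi₂ : ∀ i ∈ Finset.univ,
        Integrable (({x i} : Set ℝ).indicator fun _ => lam * f (x i)) ν := fun i _ =>
      (integrable_const _).indicator (measurableSet_singleton _)
    rw [integral_congr_ae hpt, integral_add (integrable_finsetSum _ hi₁).fun_neg
      ((integrable_finsetSum _ hi₂).const_mul c), integral_neg, integral_const_mul,
      integral_finsetSum _ hi₁, integral_finsetSum _ hi₂]
    simp only [integral_indicator (hJopen _).measurableSet,
      integral_indicator_const _ (measurableSet_singleton _), smul_eq_mul]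
  rw [Finset.sum_congr rfl fun j _ => hterm j, ← abs_neg]
  refine abs_le_of_forall_notMem_finite (K := ∑ i, ν.real {x i} * (lam * f (x i))) hSfin
    fun c hc => ?_
  rw [← hkey c hc, mul_comm (Real.sqrt _)]
  refine (hIPP (G c) (fun j y hy => (hGderiv c hy).differentiableAt.differentiableWithinAt)
    (henergy_int c hc)).trans ?_
  gcongr
  exact henergy_le c hc
end

section
/- Let −∞ ≤ α < β ≤ +∞, let h : (α,β) → ℝ be continuous and positive, let λ > 0, fix t₀ ∈ (α,β), set E(t) := exp( λ ∫_{t₀}^t u/h(u) du ) and ρ(t) := 1/(h(t) E(t)), assume ρ is integrable on (α,β), and let μ* be the probability measure with density ρ/Z where Z = ∫ ρ. Let g : (α,β) → ℝ be C¹ with g ∈ L¹(μ*), and define ψ(t) := E(t) ∫_α^t ( g(y) − ∫ g dμ* ) ρ(y) dy. Then ψ is differentiable on (α,β) and solves the Stein equation: for every t ∈ (α,β), h(t) ψ′(t) − λ t ψ(t) = g(t) − ∫ g dμ*. -/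
open MeasureTheory Real Set

noncomputable section

/-- The open interval `(α, β) ⊆ ℝ`, with possibly infinite endpoints. -/
def Ival (α β : EReal) : Set ℝ := {t : ℝ | α < (t : EReal) ∧ (t : EReal) < β}

/-- `E(t) = exp(λ ∫_{t₀}^t u/h(u) du)`. -/
def Efun (h : ℝ → ℝ) (lam t₀ : ℝ) (t : ℝ) : ℝ :=
  Real.exp (lam * ∫ u in t₀..t, u / h u)

/-- `ρ(t) = 1/(h(t) E(t))`, the unnormalized invariant density. -/
def rhoFun (h : ℝ → ℝ) (lam t₀ : ℝ) (t : ℝ) : ℝ :=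
  1 / (h t * Efun h lam t₀ t)

/-- The invariant probability measure `μ*` with density `ρ/Z` on `(α, β)`. -/
def muStar (α β : EReal) (h : ℝ → ℝ) (lam t₀ : ℝ) : MeasureTheory.Measure ℝ :=
  (MeasureTheory.volume.restrict (Ival α β)).withDensity
    (fun t => ENNReal.ofReal (rhoFun h lam t₀ t / ∫ s in Ival α β, rhoFun h lam t₀ s))

/-- The cumulative distribution function of a measure on `ℝ`. -/
def cdfFun (μ : MeasureTheory.Measure ℝ) (t : ℝ) : ℝ := (μ (Set.Iic t)).toReal

/-- The Stein solution `ψ(t) = E(t) ∫_α^t (g(y) - μ*(g)) ρ(y) dy`. -/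
def steinSol (α β : EReal) (h : ℝ → ℝ) (lam t₀ : ℝ) (g : ℝ → ℝ) (t : ℝ) : ℝ :=
  Efun h lam t₀ t *
    ∫ y in Ival α β ∩ Set.Iic t, (g y - ∫ z, g z ∂(muStar α β h lam t₀)) * rhoFun h lam t₀ y

end

lemma isOpen_Ival (α β : EReal) : IsOpen (Ival α β) :=
  isOpen_Ioo.preimage continuous_coe_real_ereal

lemma ordConnected_Ival (α β : EReal) : (Ival α β).OrdConnected :=
  ⟨fun _ hx _ hy _ hz => ⟨hx.1.trans_le (EReal.coe_le_coe_iff.2 hz.1),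
    (EReal.coe_le_coe_iff.2 hz.2).trans_lt hy.2⟩⟩

lemma Efun_pos (h : ℝ → ℝ) (lam t₀ t : ℝ) : 0 < Efun h lam t₀ t := Real.exp_pos _

lemma hasDerivAt_Efun {α β : EReal} {h : ℝ → ℝ} (hh_cont : ContinuousOn h (Ival α β))
    (hh_pos : ∀ t ∈ Ival α β, 0 < h t) (lam : ℝ) {t₀ t : ℝ} (ht₀ : t₀ ∈ Ival α β)
    (ht : t ∈ Ival α β) :
    HasDerivAt (Efun h lam t₀) (Efun h lam t₀ t * (lam * (t / h t))) t := by
  have hcont : ContinuousOn (fun u => u / h u) (Ival α β) :=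
    continuousOn_id.div hh_cont fun u hu => (hh_pos u hu).ne'
  have hint : IntervalIntegrable (fun u => u / h u) volume t₀ t :=
    (hcont.mono ((ordConnected_Ival α β).uIcc_subset ht₀ ht)).intervalIntegrable
  have hopen := isOpen_Ival α β
  exact ((intervalIntegral.integral_hasDerivAt_right hint
    (hcont.stronglyMeasurableAtFilter hopen t ht)
    (hcont.continuousAt (hopen.mem_nhds ht))).const_mul lam).exp

lemma continuousOn_rhoFun {α β : EReal} {h : ℝ → ℝ} (hh_cont : ContinuousOn h (Ival α β))
    (hh_pos : ∀ t ∈ Ival α β, 0 < h t) (lam : ℝ) {t₀ : ℝ} (ht₀ : t₀ ∈ Ival α β) :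
    ContinuousOn (rhoFun h lam t₀) (Ival α β) :=
  continuousOn_const.div
    (hh_cont.mul fun _ ht =>
      (hasDerivAt_Efun hh_cont hh_pos lam ht₀ ht).continuousAt.continuousWithinAt)
    fun t ht => (mul_pos (hh_pos t ht) (Efun_pos h lam t₀ t)).ne'

lemma rhoFun_pos {h : ℝ → ℝ} {t : ℝ} (ht : 0 < h t) (lam t₀ : ℝ) : 0 < rhoFun h lam t₀ t :=
  one_div_pos.2 (mul_pos ht (Efun_pos h lam t₀ t))

lemma setIntegral_rhoFun_pos {α β : EReal} {h : ℝ → ℝ} (hh_pos : ∀ t ∈ Ival α β, 0 < h t)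
    {lam t₀ : ℝ} (ht₀ : t₀ ∈ Ival α β) (hρ : IntegrableOn (rhoFun h lam t₀) (Ival α β)) :
    0 < ∫ s in Ival α β, rhoFun h lam t₀ s := by
  have hopen := isOpen_Ival α β
  rw [setIntegral_pos_iff_support_of_nonneg_ae _ hρ]
  · have hsupp : Ival α β ⊆ Function.support (rhoFun h lam t₀) :=
      fun t ht => (rhoFun_pos (hh_pos t ht) lam t₀).ne'
    rw [inter_eq_right.2 hsupp]
    exact hopen.measure_pos volume ⟨t₀, ht₀⟩
  · exact (ae_restrict_mem hopen.measurableSet).mono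
      fun t ht => (rhoFun_pos (hh_pos t ht) lam t₀).le

lemma integrableOn_mul_rhoFun {α β : EReal} {h : ℝ → ℝ} (hh_pos : ∀ t ∈ Ival α β, 0 < h t)
    {lam t₀ : ℝ} (ht₀ : t₀ ∈ Ival α β) (hρ : IntegrableOn (rhoFun h lam t₀) (Ival α β))
    {g : ℝ → ℝ} (hg : Integrable g (muStar α β h lam t₀)) :
    IntegrableOn (fun y => g y * rhoFun h lam t₀ y) (Ival α β) := by
  have hZ := setIntegral_rhoFun_pos hh_pos ht₀ hρ
  rw [muStar, integrable_withDensity_iff_integrable_smul₀'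
    (hρ.aestronglyMeasurable.aemeasurable.div_const _).ennreal_ofReal
    (Filter.Eventually.of_forall fun _ => ENNReal.ofReal_lt_top)] at hg
  refine (hg.mul_const (∫ s in Ival α β, rhoFun h lam t₀ s)).congr ?_
  filter_upwards [ae_restrict_mem (isOpen_Ival α β).measurableSet] with t ht
  rw [ENNReal.toReal_ofReal (div_pos (rhoFun_pos (hh_pos t ht) lam t₀) hZ).le, smul_eq_mul]
  field_simp

lemma hasDerivAt_setIntegral_inter_Iic {s : Set ℝ} (hs : IsOpen s) {f : ℝ → ℝ}
    (hf : ContinuousOn f s) (hint : IntegrableOn f s) {t : ℝ} (ht : t ∈ s) :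
    HasDerivAt (fun x => ∫ y in s ∩ Iic x, f y) (f t) t := by
  have hF : Integrable (s.indicator f) := hint.integrable_indicator hs.measurableSet
  have hev : s.indicator f =ᶠ[nhds t] f :=
    Filter.eventuallyEq_of_mem (hs.mem_nhds ht) fun _ => indicator_of_mem (f := f)
  have hcont : ContinuousAt (s.indicator f) t :=
    (hf.continuousAt (hs.mem_nhds ht)).congr hev.symm
  have key := (intervalIntegral.integral_hasDerivAt_right (hF.intervalIntegrable (a := t))
    (hF.aestronglyMeasurable.stronglyMeasurableAtFilter) hcont).add_const
      (∫ y in Iic t, s.indicator f y)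
  rw [indicator_of_mem ht] at key
  refine key.congr_of_eventuallyEq (Filter.Eventually.of_forall fun x => ?_)
  dsimp only
  rw [← intervalIntegral.integral_Iic_sub_Iic hF.integrableOn hF.integrableOn, sub_add_cancel,
    setIntegral_indicator hs.measurableSet, inter_comm]

/-- The explicit function `ψ` solves the Stein equation
`h ψ' - λ t ψ = g - μ*(g)` on `(α, β)` (formula (4.2)). -/
theorem stein_solution (α β : EReal) (hαβ : α < β)
    (h : ℝ → ℝ) (hh_cont : ContinuousOn h (Ival α β))
    (hh_pos : ∀ t ∈ Ival α β, 0 < h t)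
    (lam : ℝ) (hlam : 0 < lam)
    (t₀ : ℝ) (ht₀ : t₀ ∈ Ival α β)
    (hρ : MeasureTheory.IntegrableOn (rhoFun h lam t₀) (Ival α β))
    (g : ℝ → ℝ) (hg : ContDiffOn ℝ 1 g (Ival α β))
    (hgL1 : MeasureTheory.Integrable g (muStar α β h lam t₀)) :
    ∀ t ∈ Ival α β,
      DifferentiableAt ℝ (steinSol α β h lam t₀ g) t ∧
      h t * deriv (steinSol α β h lam t₀ g) t - lam * t * steinSol α β h lam t₀ g t
        = g t - ∫ z, g z ∂(muStar α β h lam t₀) := by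
  intro t ht
  have hopen := isOpen_Ival α β
  set m := ∫ z, g z ∂(muStar α β h lam t₀) with hm
  have hint : IntegrableOn (fun y => (g y - m) * rhoFun h lam t₀ y) (Ival α β) := by
    simp only [sub_mul]
    exact Integrable.sub (integrableOn_mul_rhoFun hh_pos ht₀ hρ hgL1) (hρ.const_mul m)
  have hcont : ContinuousOn (fun y => (g y - m) * rhoFun h lam t₀ y) (Ival α β) :=
    (hg.continuousOn.sub continuousOn_const).mul (continuousOn_rhoFun hh_cont hh_pos lam ht₀)
  have hψ : HasDerivAt (steinSol α β h lam t₀ g) _ t :=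
    (hasDerivAt_Efun hh_cont hh_pos lam ht₀ ht).mul
      (hasDerivAt_setIntegral_inter_Iic hopen hcont hint ht)
  refine ⟨hψ.differentiableAt, ?_⟩
  have hh := (hh_pos t ht).ne'
  have hE := (Efun_pos h lam t₀ t).ne'
  rw [hψ.deriv, steinSol, ← hm, rhoFun]
  field_simp
  ring
end

section
/- Let −∞ ≤ α < β ≤ +∞, let h : (α,β) → ℝ be continuous and positive, let λ > 0, fix t₀ ∈ (α,β), set ρ(t) := (1/h(t)) exp( −λ ∫_{t₀}^t u/h(u) du ), assume ρ is integrable on (α,β), and let μ* be the probability measure on (α,β) with density ρ/Z where Z = ∫ ρ. Then for every C² function ψ : (α,β) → ℝ with compact support in (α,β), ∫ h(t) ψ″(t) dμ*(t) = λ ∫ t ψ′(t) dμ*(t). -/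
open MeasureTheory Real Set

lemma rhoFun_nonneg {α β : EReal} {h : ℝ → ℝ} (hh_pos : ∀ t ∈ Ival α β, 0 < h t)
    (lam t₀ : ℝ) {t : ℝ} (ht : t ∈ Ival α β) : 0 ≤ rhoFun h lam t₀ t :=
  (one_div_pos.2 (mul_pos (hh_pos t ht) (Efun_pos h lam t₀ t))).le

/-- Integration against `μ*` of a function vanishing outside `(α, β)`. -/
lemma integral_muStar {α β : EReal} {h : ℝ → ℝ} (hh_pos : ∀ t ∈ Ival α β, 0 < h t)
    {lam t₀ : ℝ} (hρ : IntegrableOn (rhoFun h lam t₀) (Ival α β)) {f : ℝ → ℝ}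
    (hf : ∀ t ∉ Ival α β, f t = 0) :
    ∫ t, f t ∂(muStar α β h lam t₀) =
      (∫ s in Ival α β, rhoFun h lam t₀ s)⁻¹ * ∫ t, rhoFun h lam t₀ t * f t := by
  have hI : MeasurableSet (Ival α β) := (isOpen_Ival α β).measurableSet
  have hZ : 0 ≤ ∫ s in Ival α β, rhoFun h lam t₀ s :=
    setIntegral_nonneg hI fun t ht => rhoFun_nonneg hh_pos lam t₀ ht
  rw [muStar, integral_withDensity_eq_integral_toReal_smul₀
    (hρ.aemeasurable.div_const _).ennreal_ofReal (by simp), ← integral_const_mul,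
    ← setIntegral_eq_integral_of_forall_compl_eq_zero (s := Ival α β)
      (f := fun t => (∫ s in Ival α β, rhoFun h lam t₀ s)⁻¹ * (rhoFun h lam t₀ t * f t))
      (fun t ht => by rw [hf t ht, mul_zero, mul_zero])]
  refine setIntegral_congr_fun hI fun t ht => ?_
  simp only [smul_eq_mul]
  rw [ENNReal.toReal_ofReal (div_nonneg (rhoFun_nonneg hh_pos lam t₀ ht) hZ)]
  ring

lemma integrable_mul_of_tsupport_subset {U : Set ℝ} (hU : IsOpen U) {g φ : ℝ → ℝ}
    (hg : ContinuousOn g U) (hφ : Continuous φ) (hφc : HasCompactSupport φ)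
    (hφU : tsupport φ ⊆ U) : Integrable fun t => g t * φ t := by
  refine Continuous.integrable_of_hasCompactSupport ?_ hφc.mul_left
  refine (hg.mul hφ.continuousOn).continuous_of_tsupport_subset hU ?_
  exact (tsupport_mul_subset_right (f := g) (g := φ)).trans hφU

/-- The measure `μ*` with density proportional to `(1/h) exp(-λ∫ u/h)` is
invariant for the generator `Lψ = h ψ'' - λ t ψ'` (Section 4.2.1). -/
theorem muStar_invariant (α β : EReal) (hαβ : α < β)
    (h : ℝ → ℝ) (hh_cont : ContinuousOn h (Ival α β))
    (hh_pos : ∀ t ∈ Ival α β, 0 < h t)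
    (lam : ℝ) (hlam : 0 < lam)
    (t₀ : ℝ) (ht₀ : t₀ ∈ Ival α β)
    (hρ : MeasureTheory.IntegrableOn (rhoFun h lam t₀) (Ival α β)) :
    ∀ ψ : ℝ → ℝ, ContDiff ℝ 2 ψ → HasCompactSupport ψ →
      tsupport ψ ⊆ Ival α β →
      ∫ t, h t * deriv (deriv ψ) t ∂(muStar α β h lam t₀)
        = lam * ∫ t, t * deriv ψ t ∂(muStar α β h lam t₀) := by
  intro ψ hψ hψc hψI
  have hU := isOpen_Ival α β
  have hψ1 : ContDiff ℝ 1 (deriv ψ) := hψ.deriv' (n := 1)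
  have hψ2 : Continuous (deriv (deriv ψ)) := hψ1.continuous_deriv le_rfl
  have hc1 : HasCompactSupport (deriv ψ) := hψc.deriv
  have hc2 : HasCompactSupport (deriv (deriv ψ)) := hc1.deriv
  have hs1 : tsupport (deriv ψ) ⊆ Ival α β := tsupport_deriv_subset.trans hψI
  have hs2 : tsupport (deriv (deriv ψ)) ⊆ Ival α β := tsupport_deriv_subset.trans hs1
  have hz1 : ∀ t ∉ Ival α β, deriv ψ t = 0 := fun t ht =>
    image_eq_zero_of_notMem_tsupport fun h' => ht (hs1 h')
  have hz2 : ∀ t ∉ Ival α β, deriv (deriv ψ) t = 0 := fun t ht =>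
    image_eq_zero_of_notMem_tsupport fun h' => ht (hs2 h')
  have hρc := continuousOn_rhoFun hh_cont hh_pos lam ht₀
  have hi2 : Integrable fun t => rhoFun h lam t₀ t * (h t * deriv (deriv ψ) t) := by
    simpa only [Pi.mul_apply, mul_assoc] using
      integrable_mul_of_tsupport_subset hU (hρc.mul hh_cont) hψ2 hc2 hs2
  have hi1 : Integrable fun t => rhoFun h lam t₀ t * (t * deriv ψ t) := by
    simpa only [Pi.mul_apply, mul_assoc, id_eq] using
      integrable_mul_of_tsupport_subset hU (hρc.mul continuousOn_id) hψ1.continuous hc1 hs1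
  have hEinv : ContinuousOn (fun t => (Efun h lam t₀ t)⁻¹) (Ival α β) := fun t ht =>
    ((hasDerivAt_Efun hh_cont hh_pos lam ht₀ ht).continuousAt.inv₀
      (Efun_pos h lam t₀ t).ne').continuousWithinAt
  have hderiv : ∀ t, HasDerivAt (fun t => (Efun h lam t₀ t)⁻¹ * deriv ψ t)
      (rhoFun h lam t₀ t * (h t * deriv (deriv ψ) t)
        - lam * (rhoFun h lam t₀ t * (t * deriv ψ t))) t := by
    intro t
    by_cases ht : t ∈ Ival α β
    · have hE := (Efun_pos h lam t₀ t).ne'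
      have hh := (hh_pos t ht).ne'
      refine (((hasDerivAt_Efun hh_cont hh_pos lam ht₀ ht).inv hE).mul
        (hψ1.differentiable one_ne_zero t).hasDerivAt).congr_deriv ?_
      rw [rhoFun, Pi.inv_apply]
      field_simp
      ring
    · rw [hz1 t ht, hz2 t ht]
      have hev := notMem_tsupport_iff_eventuallyEq.1 fun h' => ht (hs1 h')
      simp only [mul_zero, sub_zero]
      refine (hasDerivAt_const t (0 : ℝ)).congr_of_eventuallyEq ?_
      filter_upwards [hev] with x hx
      simp [hx]
  have key := integral_eq_zero_of_hasDerivAt_of_integrable hderiv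
    (hi2.sub (hi1.const_mul lam))
    (integrable_mul_of_tsupport_subset hU hEinv hψ1.continuous hc1 hs1)
  rw [integral_sub hi2 (hi1.const_mul lam), integral_const_mul, sub_eq_zero] at key
  rw [integral_muStar hh_pos hρ fun t ht => by rw [hz2 t ht, mul_zero],
    integral_muStar hh_pos hρ fun t ht => by rw [hz1 t ht, mul_zero], key]
  ring
end

section
/- For every natural number n and every real x₀, if the derivative of the probabilist Hermite polynomial He_{n+1} vanishes at x₀, then its second derivative does not vanish at x₀: He_{n+1}′(x₀) = 0 implies He_{n+1}″(x₀) ≠ 0. Equivalently, at every critical point x₀ of He_{n+1} there is a nonzero constant c with He_{n+1}(x) − He_{n+1}(x₀) = c (x − x₀)² + o((x − x₀)²) as x → x₀. -/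
namespace Polynomial

/-- The Hermite polynomials form an Appell sequence. -/
theorem derivative_hermite_succ (n : ℕ) :
    derivative (hermite (n + 1)) = ((n : ℤ[X]) + 1) * hermite n := by
  induction n with
  | zero => simp
  | succ n ih =>
    rw [hermite_succ (n + 1), derivative_sub, derivative_mul, derivative_X, ih, derivative_mul,
      hermite_succ n]
    simp only [derivative_add, derivative_natCast, derivative_one, Nat.cast_add, Nat.cast_one]
    ring

/-- A Hermite polynomial has only simple roots. -/
theorem aeval_derivative_hermite_ne_zero {K : Type*} [Field K] [CharZero K] (n : ℕ) {x : K}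
    (h : aeval x (hermite n) = 0) : aeval x (derivative (hermite n)) ≠ 0 := by
  induction n with
  | zero => simp at h
  | succ n ih =>
    intro h'
    have hn : aeval x (hermite n) = 0 := by
      have hc : (n : K) + 1 ≠ 0 := n.cast_add_one_ne_zero
      simpa [derivative_hermite_succ, hc, -hermite_succ] using h'
    refine ih hn ?_
    simpa [hermite_succ, hn] using h

end Polynomial

/-- At every critical point of the probabilist Hermite polynomial `He_{n+1}`,
its second derivative does not vanish (Hermite polynomials are exactly
quadratic at the neighborhood of their critical points). -/
theorem hermite_second_deriv_ne_zero_at_critical (n : ℕ) (x₀ : ℝ)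
    (h : (Polynomial.aeval x₀ (Polynomial.derivative (Polynomial.hermite (n + 1))) : ℝ) = 0) :
    (Polynomial.aeval x₀
      (Polynomial.derivative (Polynomial.derivative (Polynomial.hermite (n + 1)))) : ℝ) ≠ 0 := by
  have hc : (n : ℝ) + 1 ≠ 0 := n.cast_add_one_ne_zero
  have hn : Polynomial.aeval x₀ (Polynomial.hermite n) = 0 := by
    simpa [Polynomial.derivative_hermite_succ, hc, -Polynomial.hermite_succ] using h
  simpa [Polynomial.derivative_hermite_succ, hc, -Polynomial.hermite_succ] using
    Polynomial.aeval_derivative_hermite_ne_zero n hn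
end

section
/- Let γ be the standard Gaussian measure N(0,1) on ℝ, let f₂(x) := (x² − 1)/√2, and let μ* := (f₂)_# γ be the pushforward of γ by f₂ (the law of (χ² − 1)/√2 for a chi-squared variable with one degree of freedom). Then for every C¹ function ψ : ℝ → ℝ with compact support, ∫ 2√2 ( t + 1/√2 ) ψ′(t) dμ*(t) = ∫ 2 t ψ(t) dμ*(t). -/
open MeasureTheory

/-- The standard Gaussian density `φ` satisfies `φ' = -x φ`. -/
theorem hasDerivAt_gaussianPDFReal_zero_one (x : ℝ) :
    HasDerivAt (ProbabilityTheory.gaussianPDFReal 0 1)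
      (-x * ProbabilityTheory.gaussianPDFReal 0 1 x) x := by
  have h : HasDerivAt (fun y : ℝ => -(y - 0) ^ 2 / (2 * ((1 : NNReal) : ℝ))) (-x) x := by
    refine ((((hasDerivAt_id x).sub_const 0).pow 2).neg.div_const
      (2 * ((1 : NNReal) : ℝ))).congr_deriv ?_
    simp [neg_div]
  refine (h.exp.const_mul (Real.sqrt (2 * Real.pi * ((1 : NNReal) : ℝ)))⁻¹).congr_deriv ?_
  rw [ProbabilityTheory.gaussianPDFReal_def]
  ring

/-- **Stein's identity** for the standard Gaussian measure and compactly supported `C¹`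
functions. -/
theorem integral_deriv_gaussianReal_zero_one {g : ℝ → ℝ} (hg : ContDiff ℝ 1 g)
    (hgc : HasCompactSupport g) :
    ∫ x, deriv g x ∂(ProbabilityTheory.gaussianReal 0 1)
      = ∫ x, x * g x ∂(ProbabilityTheory.gaussianReal 0 1) := by
  have hφ : Continuous (ProbabilityTheory.gaussianPDFReal 0 1) :=
    continuous_iff_continuousAt.2 fun x => (hasDerivAt_gaussianPDFReal_zero_one x).continuousAt
  have hg' : Continuous (deriv g) := hg.continuous_deriv le_rfl
  have h₁ : Integrable fun x => ProbabilityTheory.gaussianPDFReal 0 1 x * deriv g x :=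
    (hφ.mul hg').integrable_of_hasCompactSupport hgc.deriv.mul_left
  have h₂ : Integrable fun x => ProbabilityTheory.gaussianPDFReal 0 1 x * (x * g x) :=
    (hφ.mul (continuous_id.mul hg.continuous)).integrable_of_hasCompactSupport
      hgc.mul_left.mul_left
  have h₀ : Integrable fun x => ProbabilityTheory.gaussianPDFReal 0 1 x * g x :=
    (hφ.mul hg.continuous).integrable_of_hasCompactSupport hgc.mul_left
  have key := integral_eq_zero_of_hasDerivAt_of_integrable
    (f' := fun x => ProbabilityTheory.gaussianPDFReal 0 1 x * deriv g x
      - ProbabilityTheory.gaussianPDFReal 0 1 x * (x * g x))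
    (fun x => by
      refine ((hasDerivAt_gaussianPDFReal_zero_one x).mul
        ((hg.differentiable one_ne_zero).differentiableAt (x := x)).hasDerivAt).congr_deriv ?_
      ring) (h₁.sub h₂) h₀
  rw [integral_sub h₁ h₂] at key
  simp only [ProbabilityTheory.integral_gaussianReal_eq_integral_smul one_ne_zero, smul_eq_mul]
  exact sub_eq_zero.1 key

/-- Precomposition with the second Hermite polynomial preserves compactness of the support. -/
theorem HasCompactSupport.comp_hermite_two {ψ : ℝ → ℝ} (hψ : HasCompactSupport ψ) :
    HasCompactSupport fun x => ψ ((x ^ 2 - 1) / Real.sqrt 2) := by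
  obtain ⟨R, hR⟩ := hψ.isCompact.isBounded.subset_closedBall 0
  refine HasCompactSupport.intro (isCompact_closedBall 0 (R * Real.sqrt 2 + 2)) fun x hx => ?_
  refine image_eq_zero_of_notMem_tsupport fun hmem => hx ?_
  have hs : 0 < Real.sqrt 2 := by positivity
  have h := (abs_le.1 (mem_closedBall_zero_iff.1 (hR hmem))).2
  rw [div_le_iff₀ hs] at h
  rw [mem_closedBall_zero_iff, Real.norm_eq_abs]
  nlinarith [sq_abs x, sq_nonneg (|x| - 1), abs_nonneg x]

/-- Integration by parts for the pushforward of the standard Gaussian by the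
second Hermite eigenfunction `f₂(x) = (x²-1)/√2` (Section 6.1): `(f₂)_# γ`
is invariant for the Stein operator `ψ ↦ 2tψ - 2√2(t + 1/√2)ψ'`. -/
theorem chi2_pushforward_ibp :
    ∀ ψ : ℝ → ℝ, ContDiff ℝ 1 ψ → HasCompactSupport ψ →
      ∫ t, 2 * Real.sqrt 2 * (t + 1 / Real.sqrt 2) * deriv ψ t
          ∂((ProbabilityTheory.gaussianReal 0 1).map (fun x => (x ^ 2 - 1) / Real.sqrt 2))
        = ∫ t, 2 * t * ψ t
          ∂((ProbabilityTheory.gaussianReal 0 1).map (fun x => (x ^ 2 - 1) / Real.sqrt 2)) := by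
  intro ψ hψ hψc
  have hs : Real.sqrt 2 ≠ 0 := by positivity
  have hsq : Real.sqrt 2 * Real.sqrt 2 = 2 := Real.mul_self_sqrt (by norm_num)
  have hf : Continuous fun x : ℝ => (x ^ 2 - 1) / Real.sqrt 2 := by fun_prop
  have hψ' : Continuous (deriv ψ) := hψ.continuous_deriv le_rfl
  have hψ₀ : Continuous ψ := hψ.continuous
  rw [integral_map hf.aemeasurable (by fun_prop), integral_map hf.aemeasurable (by fun_prop)]
  set g : ℝ → ℝ := fun x => Real.sqrt 2 * x * ψ ((x ^ 2 - 1) / Real.sqrt 2) with hg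
  have hgC : ContDiff ℝ 1 g := by fun_prop
  have hgc : HasCompactSupport g := hψc.comp_hermite_two.mul_left
  have hderiv (x : ℝ) : deriv g x = Real.sqrt 2 * ψ ((x ^ 2 - 1) / Real.sqrt 2)
      + 2 * x ^ 2 * deriv ψ ((x ^ 2 - 1) / Real.sqrt 2) := by
    have h₁ : HasDerivAt (fun y : ℝ => (y ^ 2 - 1) / Real.sqrt 2) (2 * x / Real.sqrt 2) x := by
      simpa using ((hasDerivAt_pow 2 x).sub_const 1).div_const (Real.sqrt 2)
    have h₂ := ((hψ.differentiable one_ne_zero).differentiableAt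
      (x := (x ^ 2 - 1) / Real.sqrt 2)).hasDerivAt.comp x h₁
    refine ((((hasDerivAt_id x).const_mul (Real.sqrt 2)).mul h₂).deriv).trans ?_
    simp only [id, Function.comp]
    field_simp
  have hψi : Integrable (fun x => Real.sqrt 2 * ψ ((x ^ 2 - 1) / Real.sqrt 2))
      (ProbabilityTheory.gaussianReal 0 1) :=
    (continuous_const.mul (hψ₀.comp hf)).integrable_of_hasCompactSupport
      hψc.comp_hermite_two.mul_left
  have hg'i : Integrable (deriv g) (ProbabilityTheory.gaussianReal 0 1) :=
    (hgC.continuous_deriv le_rfl).integrable_of_hasCompactSupport hgc.deriv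
  have hgi : Integrable (fun x => x * g x) (ProbabilityTheory.gaussianReal 0 1) :=
    (continuous_id.mul hgC.continuous).integrable_of_hasCompactSupport hgc.mul_left
  calc
    _ = ∫ x, (deriv g x - Real.sqrt 2 * ψ ((x ^ 2 - 1) / Real.sqrt 2))
          ∂(ProbabilityTheory.gaussianReal 0 1) := by
      congr 1 with x
      rw [hderiv]
      field_simp
      ring
    _ = ∫ x, (x * g x - Real.sqrt 2 * ψ ((x ^ 2 - 1) / Real.sqrt 2))
          ∂(ProbabilityTheory.gaussianReal 0 1) := by
      rw [integral_sub hg'i hψi, integral_sub hgi hψi,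
        integral_deriv_gaussianReal_zero_one hgC hgc]
    _ = _ := by
      congr 1 with x
      rw [hg]
      field_simp
      linear_combination (x ^ 2 - 1) * ψ ((x ^ 2 - 1) / Real.sqrt 2) * hsq
end
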